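/- arXiv:1005.5171 — 3 statements merged into one kernel-verified Lean document; each statement's English description precedes it below -/
import Mathlib

section
/- For every integer q ≥ 1 there exist a real constant c₁ > 0 and a natural number n₀ such that for all n ≥ n₀ the following holds: every oriented graph G on a finite vertex type whose number of edges is at most c₁ · n^{2q} · (log n)^{1/q} / (log log n)^{(q+2)/q} admits a (q+1)-coloring of its edges with no monochromatic directed path on n vertices. -/
/-- A directed path with `m` edges in the digraph with adjacency `Adj`:
an injective `p : Fin (m+1) → V` with `Adj (p i) (p (i+1))` for all `i < m`. -/
def IsDiPath {V : Type} (Adj : V → V → Prop) {m : ℕ} (p : Fin (m + 1) → V) : Prop :=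
  Function.Injective p ∧ ∀ i : Fin m, Adj (p i.castSucc) (p i.succ)

/-- A path is monochromatic w.r.t. an edge coloring `c` if all consecutive edges
receive the same color. -/
def IsMono {V : Type} {q : ℕ} (c : V → V → Fin q) {m : ℕ} (p : Fin (m + 1) → V) : Prop :=
  ∃ col : Fin q, ∀ i : Fin m, c (p i.castSucc) (p i.succ) = col

/-- An oriented graph: irreflexive adjacency with no antiparallel edges. -/
def IsOriented {V : Type} (Adj : V → V → Prop) : Prop :=
  Irreflexive Adj ∧ ∀ u v : V, ¬ (Adj u v ∧ Adj v u)

section LabelingsAndPartitions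

open Finset
open scoped Classical

variable {V : Type*} {Adj : V → V → Prop} {q : ℕ}

/-- Every edge inside `C` strictly increases one of `q + 1` coordinates, which take values in
`{0, …, s - 1}`. -/
def HasLabeling (Adj : V → V → Prop) (q : ℕ) (C : Finset V) (s : ℕ) : Prop :=
  ∃ f : V → Fin (q + 1) → ℕ, (∀ v ∈ C, ∀ i, f v i < s) ∧
    ∀ u ∈ C, ∀ v ∈ C, Adj u v → ∃ i, f u i < f v i

/-- `C` splits into `K` classes, each of which has a labeling with values below `s`. -/
def HasPartition (Adj : V → V → Prop) (q : ℕ) (C : Finset V) (K s : ℕ) : Prop :=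
  ∃ P : V → ℕ, (∀ v ∈ C, P v < K) ∧ ∀ p, HasLabeling Adj q {v ∈ C | P v = p} s

/-- The vertices of `S` can be ranked so that every edge inside `S` goes up. -/
def IsAcyclicSet (Adj : V → V → Prop) (S : Finset V) : Prop :=
  ∃ h : V → ℕ, ∀ u ∈ S, ∀ v ∈ S, Adj u v → h u < h v

/-- The vertices of `U` joined to `v` by an edge, in either direction. -/
noncomputable def neighborsIn (Adj : V → V → Prop) (U : Finset V) (v : V) : Finset V :=
  {u ∈ U | Adj u v ∨ Adj v u}

lemma HasLabeling.mono {C D : Finset V} {s t : ℕ} (h : HasLabeling Adj q C s) (hD : D ⊆ C)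
    (hs : s ≤ t) : HasLabeling Adj q D t := by
  obtain ⟨f, h1, h2⟩ := h
  exact ⟨f, fun v hv i => (h1 v (hD hv) i).trans_le hs,
    fun u hu v hv => h2 u (hD hu) v (hD hv)⟩

lemma HasPartition.mono {C : Finset V} {K L s t : ℕ} (h : HasPartition Adj q C K s)
    (hK : K ≤ L) (hs : s ≤ t) : HasPartition Adj q C L t := by
  obtain ⟨P, h1, h2⟩ := h
  exact ⟨P, fun v hv => (h1 v hv).trans_le hK, fun p => (h2 p).mono subset_rfl hs⟩

lemma hasPartition_empty (s : ℕ) : HasPartition Adj q ∅ 0 s :=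
  ⟨fun _ => 0, by simp, fun p => ⟨fun _ _ => 0, by simp, by simp⟩⟩

lemma HasPartition.union {C D : Finset V} {K s : ℕ} (hC : HasPartition Adj q C K s)
    (hD : HasLabeling Adj q D s) : HasPartition Adj q (C ∪ D) (K + 1) s := by
  obtain ⟨P, h1, h2⟩ := hC
  refine ⟨fun v => if v ∈ D then K else P v, ?_, fun p => ?_⟩
  · intro v hv
    by_cases hvD : v ∈ D
    · simp [hvD]
    · have := h1 v (by simpa [hvD] using hv)
      simp only [hvD, if_false]
      omega
  · by_cases hp : p = K
    · refine hD.mono (fun v hv => ?_) le_rfl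
      simp only [mem_filter, mem_union] at hv
      by_contra hvD
      have := h1 v (by simpa [hvD] using hv.1)
      simp only [hvD, if_false] at hv
      omega
    · refine (h2 p).mono (fun v hv => ?_) le_rfl
      simp only [mem_filter, mem_union] at hv ⊢
      by_cases hvD : v ∈ D
      · simp only [hvD, if_true] at hv
        omega
      · simpa [hvD] using hv

lemma hasLabeling_of_independent {C : Finset V} (hC : ∀ u ∈ C, ∀ v ∈ C, ¬ Adj u v) {s : ℕ}
    (hs : 1 ≤ s) : HasLabeling Adj q C s :=
  ⟨fun _ _ => 0, fun _ _ _ => hs, fun u hu v hv h => (hC u hu v hv h).elim⟩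

lemma hasPartition_card (hirr : ∀ v, ¬ Adj v v) (C : Finset V) {s : ℕ} (hs : 1 ≤ s) :
    HasPartition Adj q C #C s := by
  induction C using Finset.induction_on with
  | empty => exact hasPartition_empty s
  | insert v C hv ih =>
    rw [card_insert_of_notMem hv, insert_eq, union_comm]
    exact ih.union (hasLabeling_of_independent (by simpa using hirr v) hs)

/-- Classes of a partition indexed by a cube `k ^ q` can be arranged along an antichain. -/
lemma HasPartition.hasLabeling {C : Finset V} {k s : ℕ} (hq : 1 ≤ q)
    (h : HasPartition Adj q C (k ^ q) s) : HasLabeling Adj q C (q * k * s) := by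
  obtain ⟨P, hP, hlab⟩ := h
  choose g hg1 hg2 using hlab
  have hex : ∃ X : V → Fin q → ℕ, (∀ v ∈ C, ∀ i, X v i < k) ∧
      ∀ u ∈ C, ∀ v ∈ C, X u = X v → P u = P v := by
    refine ⟨fun v i => if hv : P v < k ^ q then (finFunctionFinEquiv.symm ⟨P v, hv⟩ i : ℕ) else 0,
      fun v hv i => ?_, fun u hu v hv huv => ?_⟩
    · simp only [hP v hv, dif_pos, Fin.is_lt]
    · simp only [hP v hv, hP u hu, dif_pos] at huv
      have : finFunctionFinEquiv.symm (⟨P u, hP u hu⟩ : Fin (k ^ q)) =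
          finFunctionFinEquiv.symm ⟨P v, hP v hv⟩ := by
        funext i
        exact Fin.ext (congrFun huv i)
      simpa using finFunctionFinEquiv.symm.injective this
  obtain ⟨X, hX, hinj⟩ := hex
  refine ⟨fun v => Fin.snoc (fun i : Fin q => X v i * s + g (P v) v i.castSucc)
    ((∑ i, (k - 1 - X v i)) * s + g (P v) v (Fin.last q)), ?_, ?_⟩
  · intro v hv i
    have hgv := hg1 (P v) v (by simp [hv])
    have hk : 1 ≤ k := Nat.one_le_of_lt (hX v hv ⟨0, hq⟩)
    refine Fin.lastCases ?_ (fun i => ?_) i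
    · simp only [Fin.snoc_last]
      have h1 : ∑ i, (k - 1 - X v i) ≤ q * (k - 1) := by
        calc ∑ i, (k - 1 - X v i) ≤ ∑ _i : Fin q, (k - 1) := sum_le_sum fun i _ => Nat.sub_le _ _
          _ = q * (k - 1) := by simp
      have h2 : ∑ i, (k - 1 - X v i) + 1 ≤ q * k := by
        obtain ⟨k, rfl⟩ := Nat.exists_eq_add_of_le' hk
        simp only [Nat.add_sub_cancel] at h1 ⊢
        nlinarith
      calc _ < (∑ i, (k - 1 - X v i)) * s + s := by have := hgv (Fin.last q); omega
        _ = (∑ i, (k - 1 - X v i) + 1) * s := by ring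
        _ ≤ q * k * s := by gcongr
    · simp only [Fin.snoc_castSucc]
      have h1 := hX v hv i
      calc _ < X v i * s + s := by have := hgv i.castSucc; omega
        _ = (X v i + 1) * s := by ring
        _ ≤ (1 * k) * s := by gcongr; omega
        _ ≤ q * k * s := by gcongr
  · intro u hu v hv huv
    by_cases hXlt : ∃ j, X u j < X v j
    · obtain ⟨j, hj⟩ := hXlt
      refine ⟨j.castSucc, ?_⟩
      simp only [Fin.snoc_castSucc]
      have := hg1 (P u) u (by simp [hu]) j.castSucc
      nlinarith
    by_cases hXeq : X u = X v
    · have hpeq := hinj u hu v hv hXeq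
      obtain ⟨i, hi⟩ := hg2 (P v) u (by simp [hu, hpeq]) v (by simp [hv]) huv
      refine ⟨i, ?_⟩
      simp only [hpeq, hXeq]
      revert hi
      refine Fin.lastCases ?_ (fun i => ?_) i <;> simp
    · push Not at hXlt
      obtain ⟨j, hj⟩ := Function.ne_iff.mp hXeq
      refine ⟨Fin.last q, ?_⟩
      simp only [Fin.snoc_last]
      have hlt : ∑ i, (k - 1 - X u i) < ∑ i, (k - 1 - X v i) := by
        refine sum_lt_sum (fun i _ => ?_) ⟨j, mem_univ _, ?_⟩
        · have := hXlt i; omega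
        · have := hXlt j; have := hX u hu j; omega
      have := hg1 (P u) u (by simp [hu]) (Fin.last q)
      nlinarith

/-- Putting two sets one after the other adds up the label ranges. -/
lemma HasLabeling.union {C D : Finset V} {s t : ℕ} (hq : 1 ≤ q) (hC : HasLabeling Adj q C s)
    (hD : HasLabeling Adj q D t) : HasLabeling Adj q (C ∪ D) (s + t) := by
  obtain ⟨f, hf1, hf2⟩ := hC
  obtain ⟨g, hg1, hg2⟩ := hD
  have hne : Fin.last q ≠ 0 := by
    intro h
    have := congrArg Fin.val h
    simp only [Fin.val_last, Fin.val_zero] at this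
    omega
  refine ⟨fun v i => if v ∈ C then (if i = Fin.last q then t + f v i else f v i)
    else (if i = Fin.last q then g v i else s + g v i), ?_, ?_⟩
  · intro v hv i
    by_cases hvC : v ∈ C
    · have := hf1 v hvC i
      simp only [hvC, if_true]
      split_ifs <;> omega
    · have := hg1 v (by simpa [hvC] using hv) i
      simp only [hvC, if_false]
      split_ifs <;> omega
  · intro u hu v hv huv
    by_cases huC : u ∈ C <;> by_cases hvC : v ∈ C
    · obtain ⟨i, hi⟩ := hf2 u huC v hvC huv
      refine ⟨i, ?_⟩
      simp only [huC, hvC, if_true]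
      split_ifs <;> omega
    · refine ⟨0, ?_⟩
      have := hf1 u huC 0
      simp only [huC, hvC, if_true, if_false, hne.symm]
      omega
    · refine ⟨Fin.last q, ?_⟩
      have := hg1 u (by simpa [huC] using hu) (Fin.last q)
      simp only [huC, hvC, if_true, if_false]
      omega
    · obtain ⟨i, hi⟩ := hg2 u (by simpa [huC] using hu) v (by simpa [hvC] using hv) huv
      refine ⟨i, ?_⟩
      simp only [huC, hvC, if_false]
      split_ifs <;> omega

lemma IsAcyclicSet.mono {S T : Finset V} (h : IsAcyclicSet Adj S) (hT : T ⊆ S) :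
    IsAcyclicSet Adj T := by
  obtain ⟨f, hf⟩ := h
  exact ⟨f, fun u hu v hv => hf u (hT hu) v (hT hv)⟩

/-- The base-`s` digits of a ranking form a labeling. -/
lemma IsAcyclicSet.hasLabeling {S : Finset V} {s : ℕ} (h : IsAcyclicSet Adj S)
    (hS : #S ≤ s ^ (q + 1)) : HasLabeling Adj q S s := by
  obtain ⟨f, hf⟩ := h
  let r : V → ℕ := fun v => #{w ∈ S | f w < f v}
  have hr1 : ∀ v ∈ S, r v < s ^ (q + 1) := fun v hv =>
    (card_lt_card (filter_ssubset.2 ⟨v, hv, lt_irrefl (f v)⟩)).trans_le hS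
  have hr2 : ∀ u ∈ S, ∀ v ∈ S, Adj u v → r u < r v := fun u hu v hv huv => by
    have huv := hf u hu v hv huv
    refine card_lt_card ((ssubset_iff_of_subset fun w hw => ?_).2 ⟨u, ?_, ?_⟩)
    · simp only [mem_filter] at hw ⊢
      exact ⟨hw.1, hw.2.trans huv⟩
    · simp [hu, huv]
    · simp
  refine ⟨fun v i => if hv : r v < s ^ (q + 1) then
    (finFunctionFinEquiv.symm ⟨r v, hv⟩ i : ℕ) else 0, fun v hv i => ?_, ?_⟩
  · simp only [hr1 v hv, dif_pos, Fin.is_lt]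
  · intro u hu v hv huv
    by_contra! hcon
    simp only [hr1 v hv, hr1 u hu, dif_pos] at hcon
    have key : ∀ w (hw : w ∈ S), r w =
        ∑ i, (finFunctionFinEquiv.symm (⟨r w, hr1 w hw⟩ : Fin (s ^ (q + 1))) i : ℕ) * s ^ (i : ℕ) := by
      intro w hw
      rw [← finFunctionFinEquiv_apply, Equiv.apply_symm_apply]
    have : r v ≤ r u := by
      rw [key u hu, key v hv]
      exact sum_le_sum fun i _ => Nat.mul_le_mul_right _ (hcon i)
    exact absurd (hr2 u hu v hv huv) this.not_gt

/-- Greedy coloring of a set of bounded degree. -/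
lemma hasPartition_of_degree_lt (hirr : ∀ v, ¬ Adj v v) {W : Finset V} {d : ℕ}
    (hW : ∀ v ∈ W, #(neighborsIn Adj W v) < d) : HasPartition Adj q W d 1 := by
  suffices H : ∀ S ⊆ W, ∃ P : V → ℕ, (∀ v ∈ S, P v < d) ∧
      ∀ u ∈ S, ∀ v ∈ S, Adj u v → P u ≠ P v by
    obtain ⟨P, h1, h2⟩ := H W subset_rfl
    refine ⟨P, h1, fun p => hasLabeling_of_independent ?_ le_rfl⟩
    intro u hu v hv huv
    simp only [mem_filter] at hu hv
    exact h2 u hu.1 v hv.1 huv (hu.2.trans hv.2.symm)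
  intro S
  induction S using Finset.induction_on with
  | empty => exact fun _ => ⟨fun _ => 0, by simp, by simp⟩
  | insert v S hv ih =>
    intro hSW
    obtain ⟨P, h1, h2⟩ := ih ((subset_insert v S).trans hSW)
    have hlt : #((neighborsIn Adj S v).image P) < #(range d) := by
      rw [card_range]
      refine card_image_le.trans_lt ((card_le_card ?_).trans_lt (hW v (hSW (mem_insert_self v S))))
      exact filter_subset_filter _ ((subset_insert v S).trans hSW)
    obtain ⟨p, hp, hpn⟩ := exists_mem_notMem_of_card_lt_card hlt
    have hpn' : ∀ u ∈ S, Adj u v ∨ Adj v u → P u ≠ p := fun u hu huv hup =>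
      hpn (mem_image.2 ⟨u, by simp [neighborsIn, hu, huv], hup⟩)
    have hne : ∀ u ∈ S, u ≠ v := fun u hu h => hv (h ▸ hu)
    refine ⟨Function.update P v p, ?_, ?_⟩
    · intro u hu
      rcases mem_insert.1 hu with rfl | hu
      · simpa using hp
      · rw [Function.update_of_ne (hne u hu)]
        exact h1 u hu
    · intro u hu w hw huw
      rcases mem_insert.1 hu with rfl | hu' <;> rcases mem_insert.1 hw with rfl | hw'
      · exact (hirr _ huw).elim
      · rw [Function.update_of_ne (hne w hw'), Function.update_self]
        exact (hpn' w hw' (Or.inr huw)).symm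
      · rw [Function.update_of_ne (hne u hu'), Function.update_self]
        exact hpn' u hu' (Or.inl huw)
      · rw [Function.update_of_ne (hne u hu'), Function.update_of_ne (hne w hw')]
        exact h2 u hu' w hw' huw

/-- A set of `2 ^ b` vertices of an oriented graph contains an acyclic set of size `b + 1`. -/
lemma exists_isAcyclicSet_of_two_pow_le (hirr : ∀ v, ¬ Adj v v)
    (hanti : ∀ u v, ¬ (Adj u v ∧ Adj v u)) (b : ℕ) (U : Finset V) (hU : 2 ^ b ≤ #U) :
    ∃ T ⊆ U, #T = b + 1 ∧ IsAcyclicSet Adj T := by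
  induction b generalizing U with
  | zero =>
    obtain ⟨v, hv⟩ := card_pos.1 (show 0 < #U by simpa using hU)
    exact ⟨{v}, by simpa using hv, by simp, fun _ => 0, by simpa using hirr v⟩
  | succ b ih =>
    have hv : ∃ v ∈ U, 2 * #{u ∈ U | Adj u v} < #U := by
      by_contra! hcon
      have h1 : #U * #U ≤ ∑ v ∈ U, 2 * #{u ∈ U | Adj u v} := by
        rw [← smul_eq_mul, ← sum_const]
        exact sum_le_sum hcon
      have h2 : ∑ v ∈ U, 2 * #{u ∈ U | Adj u v} ≤ ∑ v ∈ U, (#U - 1) := by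
        calc ∑ v ∈ U, 2 * #{u ∈ U | Adj u v}
            = ∑ v ∈ U, #{u ∈ U | Adj u v} + ∑ v ∈ U, #{u ∈ U | Adj v u} := by
              rw [← mul_sum, two_mul]
              congr 1
              exact sum_card_bipartiteAbove_eq_sum_card_bipartiteBelow (fun u v => Adj v u)
          _ = ∑ v ∈ U, #({u ∈ U | Adj u v} ∪ {u ∈ U | Adj v u}) := by
              rw [← sum_add_distrib]
              refine sum_congr rfl fun v _ => (card_union_of_disjoint ?_).symm
              exact disjoint_filter.2 fun u _ h1 h2 => hanti u v ⟨h1, h2⟩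
          _ ≤ ∑ v ∈ U, (#U - 1) := by
              refine sum_le_sum fun v hv => ?_
              rw [← card_erase_of_mem hv]
              refine card_le_card fun u hu => ?_
              simp only [mem_union, mem_filter] at hu
              refine mem_erase.2 ⟨?_, by tauto⟩
              rintro rfl
              exact hirr u (by tauto)
      rw [sum_const, smul_eq_mul] at h2
      have hpos : 0 < #U := (Nat.pow_pos two_pos).trans_le hU
      have := Nat.le_of_mul_le_mul_left (h1.trans h2) hpos
      omega
    obtain ⟨v, hvU, hv⟩ := hv
    have hcard : #U ≤ #{u ∈ U.erase v | ¬ Adj u v} + #{u ∈ U | Adj u v} + 1 := by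
      have h1 := card_filter_add_card_filter_not (s := U.erase v) (fun u => Adj u v)
      rw [card_erase_of_mem hvU] at h1
      have h2 : #{u ∈ U.erase v | Adj u v} ≤ #{u ∈ U | Adj u v} :=
        card_le_card (filter_subset_filter _ (erase_subset _ _))
      omega
    obtain ⟨T, hT, hTcard, h, hh⟩ := ih {u ∈ U.erase v | ¬ Adj u v} (by
      rw [pow_succ] at hU
      omega)
    have hT' : ∀ u ∈ T, u ≠ v ∧ u ∈ U ∧ ¬ Adj u v := fun u hu => by
      simpa [and_assoc] using hT hu
    have hvT : v ∉ T := fun hvT => (hT' v hvT).1 rfl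
    refine ⟨insert v T, insert_subset hvU fun u hu => (hT' u hu).2.1, by
      rw [card_insert_of_notMem hvT, hTcard], fun u => if u = v then 0 else h u + 1, ?_⟩
    intro u hu w hw huw
    rcases mem_insert.1 hu with rfl | hu' <;> rcases mem_insert.1 hw with rfl | hw'
    · exact (hirr _ huw).elim
    · simp [(hT' w hw').1]
    · exact ((hT' u hu').2.2 huw).elim
    · simpa [(hT' w hw').1, (hT' u hu').1] using hh u hu' w hw' huw

lemma card_powerset_filter_card_le (S : Finset V) (b : ℕ) :
    #{B ∈ S.powerset | #B ≤ b} ≤ (#S + 1) ^ b := by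
  have h1 : #(Fintype.piFinset fun _ : Fin b => insertNone S) = (#S + 1) ^ b := by
    simp
  rw [← h1]
  refine card_le_card_of_surjOn
    (fun g : Fin b → Option V => {x ∈ S | ∃ i, g i = some x}) ?_
  intro B hB
  simp only [coe_filter, mem_powerset, Set.mem_ofPred_eq] at hB
  obtain ⟨hBS, hBb⟩ := hB
  refine ⟨fun i => if hi : (i : ℕ) < #B then some (B.equivFin.symm ⟨i, hi⟩ : V) else none, ?_, ?_⟩
  · simp only [mem_coe, Fintype.mem_piFinset]
    intro i
    split_ifs with hi
    · rw [some_mem_insertNone]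
      exact hBS (B.equivFin.symm ⟨i, hi⟩).2
    · exact none_mem_insertNone
  · ext x
    simp only [mem_filter]
    constructor
    · rintro ⟨_, i, hi⟩
      split_ifs at hi with hlt
      simp only [Option.some.injEq] at hi
      rw [← hi]
      exact (B.equivFin.symm ⟨i, hlt⟩).2
    · intro hx
      refine ⟨hBS hx, ⟨(B.equivFin ⟨x, hx⟩ : ℕ), by have := (B.equivFin ⟨x, hx⟩).2; omega⟩, ?_⟩
      simp

lemma sum_card_neighborsIn_comm (S U : Finset V) :
    ∑ w ∈ U, #(neighborsIn Adj S w) = ∑ v ∈ S, #(neighborsIn Adj U v) := by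
  refine (sum_card_bipartiteAbove_eq_sum_card_bipartiteBelow (s := U) (t := S)
    (fun w v => Adj v w ∨ Adj w v)).trans (sum_congr rfl fun v _ => ?_)
  simp only [neighborsIn, bipartiteBelow, or_comm]

/-- An Erdős–Szemerédi type bound: in a sparse oriented graph there are acyclic sets much larger
than logarithmic. -/
lemma exists_isAcyclicSet_card_eq (hirr : ∀ v, ¬ Adj v v)
    (hanti : ∀ u v, ¬ (Adj u v ∧ Adj v u)) {U : Finset V} {D b r : ℕ}
    (hD : ∀ v ∈ U, #(neighborsIn Adj U v) ≤ D) (hr : 4 * (r * D) ≤ b * #U)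
    (hrU : 4 * r ≤ #U) (hU : 2 * ((r + 1) ^ b * 2 ^ b) ≤ #U) :
    ∃ S ⊆ U, #S = r ∧ IsAcyclicSet Adj S := by
  suffices H : ∃ S ⊆ U, r ≤ #S ∧ IsAcyclicSet Adj S by
    obtain ⟨S, hSU, hS, hac⟩ := H
    obtain ⟨T, hTS, hT⟩ := exists_subset_card_eq hS
    exact ⟨T, hTS.trans hSU, hT, hac.mono hTS⟩
  obtain ⟨S, hS, hmax⟩ := exists_max_image {S ∈ U.powerset | IsAcyclicSet Adj S} card
    ⟨∅, by simpa using ⟨fun _ => 0, by simp⟩⟩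
  simp only [mem_filter, mem_powerset] at hS hmax
  obtain ⟨hSU, f, hf⟩ := hS
  by_contra hcon
  replace hcon : ∀ S ⊆ U, IsAcyclicSet Adj S → #S < r := fun S hSU hac =>
    not_le.1 fun hle => hcon ⟨S, hSU, hle, hac⟩
  have hSr : #S < r := hcon S hSU ⟨f, hf⟩
  let G : Finset V := {w ∈ U \ S | #(neighborsIn Adj S w) ≤ b}
  have hbad : b * #{w ∈ U | ¬ #(neighborsIn Adj S w) ≤ b} ≤ r * D := by
    calc b * #{w ∈ U | ¬ #(neighborsIn Adj S w) ≤ b}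
        = ∑ w ∈ U with ¬ #(neighborsIn Adj S w) ≤ b, b := by rw [sum_const, smul_eq_mul, mul_comm]
      _ ≤ ∑ w ∈ U with ¬ #(neighborsIn Adj S w) ≤ b, #(neighborsIn Adj S w) :=
          sum_le_sum fun w hw => by
            simp only [mem_filter] at hw
            omega
      _ ≤ ∑ w ∈ U, #(neighborsIn Adj S w) :=
          sum_le_sum_of_subset (filter_subset _ _)
      _ = ∑ v ∈ S, #(neighborsIn Adj U v) := sum_card_neighborsIn_comm S U
      _ ≤ ∑ v ∈ S, D := sum_le_sum fun v hv => hD v (hSU hv)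
      _ = #S * D := by rw [sum_const, smul_eq_mul]
      _ ≤ r * D := by gcongr
  have hb : 0 < b := by
    rcases Nat.eq_zero_or_pos b with rfl | hb
    · have hr0 : 0 < r := by omega
      have hUpos : 0 < #U := by omega
      obtain ⟨v, hv⟩ := card_pos.1 hUpos
      simp only [zero_mul, nonpos_iff_eq_zero, mul_eq_zero, OfNat.ofNat_ne_zero, false_or] at hr
      have hD0 : D = 0 := by omega
      have := hcon U subset_rfl ⟨fun _ => 0, fun u hu v hv huv => by
        have h1 := hD v hv
        rw [hD0, nonpos_iff_eq_zero, card_eq_zero] at h1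
        have : u ∈ neighborsIn Adj U v := by simp [neighborsIn, hu, huv]
        rw [h1] at this
        simp at this⟩
      omega
    · exact hb
  have hbad' : 4 * #{w ∈ U | ¬ #(neighborsIn Adj S w) ≤ b} ≤ #U := by
    refine Nat.le_of_mul_le_mul_left (c := b) ?_ hb
    calc _ = 4 * (b * #{w ∈ U | ¬ #(neighborsIn Adj S w) ≤ b}) := by ring
      _ ≤ 4 * (r * D) := by gcongr
      _ ≤ b * #U := hr
  have hG : #U ≤ 2 * #G := by
    have h1 : #U ≤ #G + #S + #{w ∈ U | ¬ #(neighborsIn Adj S w) ≤ b} := by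
      calc #U ≤ #((G ∪ S) ∪ {w ∈ U | ¬ #(neighborsIn Adj S w) ≤ b}) := by
            refine card_le_card fun w hw => ?_
            simp only [G, mem_union, mem_filter, mem_sdiff]
            tauto
        _ ≤ _ := (card_union_le _ _).trans (Nat.add_le_add_right (card_union_le _ _) _)
    omega
  obtain ⟨B, hB, hfib⟩ := exists_le_card_fiber_of_mul_le_card_of_maps_to
    (s := G) (t := {B ∈ S.powerset | #B ≤ b}) (f := fun w => neighborsIn Adj S w) (n := 2 ^ b)
    (fun w hw => by
      simp only [G, mem_filter] at hw
      simp only [mem_filter, mem_powerset]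
      exact ⟨filter_subset _ _, hw.2⟩)
    ⟨∅, by simp⟩
    (by
      have h1 : (#S + 1) ^ b ≤ (r + 1) ^ b := by gcongr
      have h2 := card_powerset_filter_card_le S b
      have h3 : #{B ∈ S.powerset | #B ≤ b} * 2 ^ b ≤ (r + 1) ^ b * 2 ^ b := by
        gcongr
        omega
      omega)
  simp only [mem_filter, mem_powerset] at hB
  obtain ⟨T, hT, hTcard, g, hg⟩ := exists_isAcyclicSet_of_two_pow_le hirr hanti b _ hfib
  have hT' : ∀ w ∈ T, w ∈ U ∧ w ∉ S ∧ neighborsIn Adj S w = B := fun w hw => by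
    have := hT hw
    simp only [G, mem_filter, mem_sdiff] at this
    tauto
  have hno : ∀ w ∈ T, ∀ u ∈ S, u ∉ B → ¬ (Adj u w ∨ Adj w u) := fun w hw u hu huB h => by
    rw [← (hT' w hw).2.2] at huB
    exact huB (by simp [neighborsIn, hu, h])
  have hdisj : Disjoint (S \ B) T :=
    disjoint_left.2 fun u hu huT => (hT' u huT).2.1 (mem_sdiff.1 hu).1
  have hle := hmax ((S \ B) ∪ T) ⟨?_, fun v => if v ∈ T then g v else f v, ?_⟩
  · rw [card_union_of_disjoint hdisj, card_sdiff_of_subset hB.1, hTcard] at hle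
    have := card_le_card hB.1
    omega
  · exact union_subset (sdiff_subset.trans hSU) fun w hw => (hT' w hw).1
  · intro u hu v hv huv
    have hmem : ∀ x ∈ S \ B ∪ T, x ∉ T → x ∈ S ∧ x ∉ B := fun x hx hxT => by
      simpa [hxT] using hx
    by_cases huT : u ∈ T <;> by_cases hvT : v ∈ T
    · simpa [huT, hvT] using hg u huT v hvT huv
    · exact (hno u huT v (hmem v hv hvT).1 (hmem v hv hvT).2 (Or.inr huv)).elim
    · exact (hno v hvT u (hmem u hu huT).1 (hmem u hu huT).2 (Or.inl huv)).elim
    · simpa [huT, hvT] using hf u (hmem u hu huT).1 v (hmem v hv hvT).1 huv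

/-- Disjoint acyclic sets of a fixed size can be collected as long as half of the vertices are
left. -/
lemma exists_hasPartition_of_isAcyclicSet {R : Finset V} {s : ℕ}
    (hR : ∀ R' ⊆ R, #R ≤ 2 * #R' → ∃ S ⊆ R', #S = s ^ (q + 1) ∧ IsAcyclicSet Adj S) (j : ℕ)
    (hj : 2 * (j * s ^ (q + 1)) ≤ #R) :
    ∃ C ⊆ R, #C = j * s ^ (q + 1) ∧ HasPartition Adj q C j s := by
  induction j with
  | zero => exact ⟨∅, by simp, by simp, hasPartition_empty s⟩
  | succ j ih =>
    obtain ⟨C, hCR, hC, hpart⟩ := ih (by nlinarith)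
    obtain ⟨S, hSR, hS, hac⟩ := hR (R \ C) sdiff_subset (by
      rw [card_sdiff_of_subset hCR, hC]
      have : (j + 1) * s ^ (q + 1) = j * s ^ (q + 1) + s ^ (q + 1) := by ring
      omega)
    refine ⟨C ∪ S, union_subset hCR (hSR.trans sdiff_subset), ?_,
      hpart.union (hac.hasLabeling hS.le)⟩
    rw [card_union_of_disjoint (disjoint_of_subset_right hSR disjoint_sdiff), hC, hS]
    ring

/-- Iterated extraction of classes containing a proportion `1 / A` of the current set. -/
lemma hasPartition_of_forall_exists (hirr : ∀ v, ¬ Adj v v) {W : Finset V} {A N s : ℕ}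
    (hs : 1 ≤ s) (hW : ∀ R ⊆ W, N < #R → ∃ C ⊆ R, #R ≤ A * #C ∧ HasLabeling Adj q C s)
    (j : ℕ) {R : Finset V} (hR : R ⊆ W) (hj : #R ≤ 2 ^ j * N) :
    HasPartition Adj q R (N + A * j) s := by
  induction j generalizing R with
  | zero => exact (hasPartition_card hirr R hs).mono (by simpa using hj) le_rfl
  | succ j ih =>
    suffices H : ∀ t : ℕ, ∀ R ⊆ W, A * #R ≤ A * (2 ^ j * N) + t * (2 ^ j * N) →
        HasPartition Adj q R (N + A * j + t) s by
      refine (H A R hR ?_).mono (by rw [mul_add]; omega) le_rfl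
      calc A * #R ≤ A * (2 ^ (j + 1) * N) := by gcongr
        _ = _ := by ring
    intro t
    have hpow : N ≤ 2 ^ j * N := Nat.le_mul_of_pos_left _ (by positivity)
    induction t with
    | zero =>
      intro R hR hle
      refine ih hR ?_
      by_contra! hlt
      obtain ⟨C, hCR, hC, -⟩ := hW R hR (by omega)
      have hA : 0 < A := by
        rcases Nat.eq_zero_or_pos A with rfl | hA
        · omega
        · exact hA
      have := Nat.le_of_mul_le_mul_left (c := A) (by simpa using hle) hA
      omega
    | succ t iht =>
      intro R hR hle
      by_cases hN : #R ≤ 2 ^ j * N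
      · exact (ih hR hN).mono (by omega) le_rfl
      · obtain ⟨C, hCR, hC, hlab⟩ := hW R hR (by omega)
        have hpart := (iht (R \ C) (sdiff_subset.trans hR) (by
          rw [card_sdiff_of_subset hCR, Nat.mul_sub]
          have : (t + 1) * (2 ^ j * N) = t * (2 ^ j * N) + 2 ^ j * N := by ring
          omega)).union hlab
        rwa [sdiff_union_of_subset hCR] at hpart

lemma sum_card_neighborsIn_le [Fintype V] (U : Finset V) :
    ∑ v ∈ U, #(neighborsIn Adj U v) ≤ 2 * #{e : V × V | Adj e.1 e.2} := by
  have hle : ∑ v ∈ U, #{u ∈ U | Adj v u} ≤ #{e : V × V | Adj e.1 e.2} := by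
    rw [← card_sigma]
    refine card_le_card_of_injOn (fun x => (x.1, x.2)) ?_ ?_
    · intro x hx
      simp only [coe_sigma, Set.mem_sigma_iff, mem_coe, mem_filter] at hx
      simpa using hx.2.2
    · rintro ⟨a, b⟩ _ ⟨c, d⟩ _ h
      simpa using h
  have hcomm : ∑ v ∈ U, #{u ∈ U | Adj u v} = ∑ v ∈ U, #{u ∈ U | Adj v u} :=
    sum_card_bipartiteAbove_eq_sum_card_bipartiteBelow (fun u v => Adj v u)
  calc ∑ v ∈ U, #(neighborsIn Adj U v)
      ≤ ∑ v ∈ U, (#{u ∈ U | Adj u v} + #{u ∈ U | Adj v u}) := by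
        refine sum_le_sum fun v _ => ?_
        rw [neighborsIn, filter_or]
        exact card_union_le _ _
    _ = 2 * ∑ v ∈ U, #{u ∈ U | Adj v u} := by rw [sum_add_distrib, hcomm, two_mul]
    _ ≤ _ := by gcongr

lemma card_le_two_mul_card_low_degree [Fintype V] (R : Finset V) :
    #R ≤ 2 * #{v ∈ R | #(neighborsIn Adj R v) * #R ≤ 4 * #{e : V × V | Adj e.1 e.2}} := by
  set m := #{e : V × V | Adj e.1 e.2} with hm
  have hsplit := card_filter_add_card_filter_not (s := R)
    (fun v => #(neighborsIn Adj R v) * #R ≤ 4 * m)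
  have hbad : #{v ∈ R | ¬ #(neighborsIn Adj R v) * #R ≤ 4 * m} * (4 * m + 1) ≤ #R * (2 * m) := by
    calc _ = ∑ v ∈ R with ¬ #(neighborsIn Adj R v) * #R ≤ 4 * m, (4 * m + 1) := by
          rw [sum_const, smul_eq_mul]
      _ ≤ ∑ v ∈ R with ¬ #(neighborsIn Adj R v) * #R ≤ 4 * m, #(neighborsIn Adj R v) * #R :=
          sum_le_sum fun v hv => by
            simp only [mem_filter] at hv
            omega
      _ ≤ ∑ v ∈ R, #(neighborsIn Adj R v) * #R := sum_le_sum_of_subset (filter_subset _ _)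
      _ = #R * ∑ v ∈ R, #(neighborsIn Adj R v) := by rw [← sum_mul, mul_comm]
      _ ≤ #R * (2 * m) := by
          gcongr
          exact sum_card_neighborsIn_le R
  have h2 : 2 * #{v ∈ R | ¬ #(neighborsIn Adj R v) * #R ≤ 4 * m} ≤ #R := by
    rcases Nat.eq_zero_or_pos m with h0 | hpos
    · rw [h0] at hbad ⊢
      omega
    · refine Nat.le_of_mul_le_mul_left (c := 2 * m) ?_ (by positivity)
      nlinarith
  omega

lemma exists_isAcyclicSet_of_edges_le [Fintype V] (hirr : ∀ v, ¬ Adj v v)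
    (hanti : ∀ u v, ¬ (Adj u v ∧ Adj v u)) {R : Finset V} {b r : ℕ}
    (hR : 4 * ((r + 1) ^ b * 2 ^ b) ≤ #R) (hrR : 8 * r ≤ #R)
    (hr : 4 * r ≤ b ∨ 32 * (r * #{e : V × V | Adj e.1 e.2}) ≤ b * #R ^ 2) :
    ∃ S ⊆ R, #S = r ∧ IsAcyclicSet Adj S := by
  set m := #{e : V × V | Adj e.1 e.2} with hm
  have hU := card_le_two_mul_card_low_degree (Adj := Adj) R
  rw [← hm] at hU
  set U := {v ∈ R | #(neighborsIn Adj R v) * #R ≤ 4 * m} with hUdef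
  have hUR : U ⊆ R := filter_subset _ _
  have hex : ∃ D, (∀ v ∈ U, #(neighborsIn Adj U v) ≤ D) ∧ 4 * (r * D) ≤ b * #U := by
    rcases hr with hr | hr
    · refine ⟨#U, fun v _ => card_le_card (filter_subset _ _), ?_⟩
      calc 4 * (r * #U) = (4 * r) * #U := by ring
        _ ≤ b * #U := by gcongr
    · have hRpos : 0 < #R := lt_of_lt_of_le (by positivity) hR
      refine ⟨4 * m / #R, fun v hv => ?_, ?_⟩
      · rw [Nat.le_div_iff_mul_le hRpos]
        simp only [hUdef, mem_filter] at hv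
        refine le_trans ?_ hv.2
        gcongr
        exact filter_subset_filter _ hUR
      · refine Nat.le_of_mul_le_mul_left (c := 2 * #R) ?_ (by positivity)
        have h1 : 4 * m / #R * #R ≤ 4 * m := Nat.div_mul_le_self _ _
        calc 2 * #R * (4 * (r * (4 * m / #R))) = 8 * r * (4 * m / #R * #R) := by ring
          _ ≤ 8 * r * (4 * m) := by gcongr
          _ = 32 * (r * m) := by ring
          _ ≤ b * #R ^ 2 := hr
          _ = b * #R * #R := by ring
          _ ≤ b * #R * (2 * #U) := by gcongr
          _ = _ := by ring
  obtain ⟨D, hD, hrD⟩ := hex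
  obtain ⟨S, hS, h⟩ := exists_isAcyclicSet_card_eq hirr hanti hD hrD (by omega) (by omega)
  exact ⟨S, hS.trans hUR, h⟩

/-- The extraction step: a large set `R` of vertices in a sparse oriented graph contains a set that
can be labeled with values below `s` and has a controlled proportion of the size of `R`. -/
lemma exists_hasLabeling_of_edges_le [Fintype V] (hirr : ∀ v, ¬ Adj v v)
    (hanti : ∀ u v, ¬ (Adj u v ∧ Adj v u)) (hq : 1 ≤ q) {l s b N : ℕ} (hsb : s ^ q * l ≤ b)
    (hl : 1 ≤ l) (hqs : q ≤ s) (hb : 4 ≤ b) (hN : 8 * ((b ^ 2 + 1) ^ b * 2 ^ b) ≤ N)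
    (hm : 512 * q * #{e : V × V | Adj e.1 e.2} ≤ (N * s ^ q) ^ 2 * l * s) {R : Finset V}
    (hR : 512 * q * #R ≤ 2 * (N * s ^ q) * s) (hNR : N < #R) :
    ∃ C ⊆ R, #R ≤ (2 * q) ^ q * N * #C ∧ HasLabeling Adj q C s := by
  set m := #{e : V × V | Adj e.1 e.2} with hmdef
  set Z := N * s ^ q with hZdef
  have hNpos : 0 < N := lt_of_lt_of_le (by positivity) hN
  have hs : 0 < s := by omega
  have hZ : 0 < Z := by positivity
  obtain ⟨t, ht1, hRt, ht⟩ : ∃ t, 1 ≤ t ∧ #R ≤ Z * t ∧ (t = 1 ∨ Z * t ≤ 2 * #R) := by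
    refine ⟨(#R + Z - 1) / Z, ?_, ?_, ?_⟩
    · rw [Nat.le_div_iff_mul_le hZ]
      omega
    · have := Nat.lt_mul_div_succ (#R + Z - 1) hZ
      rw [mul_add] at this
      omega
    · have h1 := Nat.mul_div_le (#R + Z - 1) Z
      rcases le_or_gt Z #R with h | h
      · right
        omega
      · left
        refine Nat.div_eq_of_lt_le (by omega) (by omega)
  have hqt : q * t ≤ s := by
    rcases ht with rfl | ht
    · simpa using hqs
    · refine Nat.le_of_mul_le_mul_left (c := 512 * Z) ?_ (by positivity)
      calc 512 * Z * (q * t) = 512 * q * (Z * t) := by ring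
        _ ≤ 512 * q * (2 * #R) := by gcongr
        _ = 2 * (512 * q * #R) := by ring
        _ ≤ 2 * (2 * Z * s) := by gcongr
        _ ≤ 512 * Z * s := by nlinarith
  have hqtpos : 0 < q * t := by positivity
  set k := s / (q * t) with hk
  have hk1 : 1 ≤ k := by
    rw [hk, Nat.le_div_iff_mul_le hqtpos]
    omega
  have hks : k * (q * t) ≤ s := Nat.div_mul_le_self _ _
  have hsk : s ≤ 2 * q * t * k := by
    have h1 := Nat.lt_mul_div_succ s hqtpos
    rw [← hk] at h1
    calc s ≤ q * t * (k + 1) := h1.le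
      _ ≤ q * t * (k + k) := by gcongr
      _ = _ := by ring
  have hts : t ≤ s := (Nat.le_mul_of_pos_left t hq).trans hqt
  have hkts : k * t ≤ s := le_trans (by gcongr; exact Nat.le_mul_of_pos_left t hq) hks
  have hsqb : s ^ (q + 1) ≤ b ^ 2 := by
    have h1 : s ^ q ≤ b := le_trans (Nat.le_mul_of_pos_right _ hl) hsb
    have h2 : s ≤ b := (Nat.le_self_pow (by omega) s).trans h1
    rw [pow_succ, sq]
    gcongr
  have hbN : 16 * b ^ 2 ≤ N := by
    have h1 : b ^ 2 + 1 ≤ (b ^ 2 + 1) ^ b := Nat.le_self_pow (by omega) _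
    have h2 : 2 ≤ 2 ^ b := Nat.le_self_pow (by omega) _
    calc 16 * b ^ 2 ≤ 8 * ((b ^ 2 + 1) * 2) := by omega
      _ ≤ 8 * ((b ^ 2 + 1) ^ b * 2 ^ b) := by gcongr
      _ ≤ N := hN
  have htb : t ^ (q + 1) ≤ b ^ 2 := (Nat.pow_le_pow_left hts _).trans hsqb
  obtain ⟨C, hCR, hC, hpart⟩ := exists_hasPartition_of_isAcyclicSet (Adj := Adj) (q := q) (R := R)
    (s := t) (fun R' hR' hle => by
      refine exists_isAcyclicSet_of_edges_le hirr hanti (b := b) ?_ (by omega) ?_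
      · have h1 : (t ^ (q + 1) + 1) ^ b * 2 ^ b ≤ (b ^ 2 + 1) ^ b * 2 ^ b := by gcongr
        omega
      · rcases ht with rfl | ht
        · left
          simpa using hb
        · right
          obtain ⟨p, rfl⟩ := Nat.exists_eq_add_of_le' hq
          refine Nat.le_of_mul_le_mul_left (c := 512 ^ (p + 1) * Z ^ (p + 2)) ?_ (by positivity)
          have hm' : 512 * m ≤ Z ^ 2 * l * s := le_trans (by nlinarith) hm
          have hR'' : 512 * #R ≤ 2 * Z * s := le_trans (by nlinarith) hR
          calc 512 ^ (p + 1) * Z ^ (p + 2) * (32 * (t ^ (p + 1 + 1) * m))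
              = 32 * 512 ^ p * (Z * t) ^ (p + 2) * (512 * m) := by ring
            _ ≤ 32 * 512 ^ p * (2 * #R) ^ (p + 2) * (Z ^ 2 * l * s) := by gcongr
            _ = 128 * 2 ^ p * (512 * #R) ^ p * #R ^ 2 * (Z ^ 2 * l * s) := by ring
            _ ≤ 128 * 2 ^ p * (2 * Z * s) ^ p * #R ^ 2 * (Z ^ 2 * l * s) := by gcongr
            _ = 128 * 4 ^ p * Z ^ (p + 2) * (s ^ (p + 1) * l) * #R ^ 2 := by
              have h4 : 4 ^ p = 2 ^ p * 2 ^ p := by rw [← mul_pow]; norm_num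
              rw [h4]
              ring
            _ ≤ 128 * 4 ^ p * Z ^ (p + 2) * b * (2 * #R') ^ 2 := by gcongr
            _ = 512 * 4 ^ p * Z ^ (p + 2) * b * #R' ^ 2 := by ring
            _ ≤ 512 * 512 ^ p * Z ^ (p + 2) * b * #R' ^ 2 := by gcongr; norm_num
            _ = _ := by ring) (k ^ q) (by
      have h1 : k ^ q * t ^ (q + 1) ≤ s ^ (q + 1) := by
        calc k ^ q * t ^ (q + 1) = (k * t) ^ q * t := by ring
          _ ≤ s ^ q * s := by gcongr
          _ = _ := by ring
      omega)
  refine ⟨C, hCR, ?_, (hpart.hasLabeling hq).mono subset_rfl (by linarith)⟩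
  calc #R ≤ Z * t := hRt
    _ ≤ N * (2 * q * t * k) ^ q * t := by rw [hZdef]; gcongr
    _ = (2 * q) ^ q * N * (k ^ q * t ^ (q + 1)) := by ring
    _ = _ := by rw [hC]

/-- A sparse oriented graph has a labeling with few values. -/
theorem hasLabeling_univ_of_edges_le [Fintype V] (hirr : ∀ v, ¬ Adj v v)
    (hanti : ∀ u v, ¬ (Adj u v ∧ Adj v u)) (hq : 1 ≤ q) {l s b N k : ℕ} (hsb : s ^ q * l ≤ b)
    (hl : 1 ≤ l) (hqs : q ≤ s) (hb : 4 ≤ b) (hN : 8 * ((b ^ 2 + 1) ^ b * 2 ^ b) ≤ N)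
    (hbl : s ≤ 2 ^ l) (hk : l * N ≤ k ^ q)
    (hm : 512 * q * #{e : V × V | Adj e.1 e.2} ≤ (N * s ^ q) ^ 2 * l * s) :
    HasLabeling Adj q univ (q * ((2 * q) ^ q * (q + 1) + 2) * k * s) := by
  set m := #{e : V × V | Adj e.1 e.2} with hmdef
  set Z := N * s ^ q with hZdef
  have hNpos : 0 < N := lt_of_lt_of_le (by positivity) hN
  have hs : 0 < s := by omega
  have hZ : 0 < Z := by positivity
  let W : Finset V := {v | l * Z ≤ #(neighborsIn Adj univ v)}
  have hWcard : 512 * q * #W ≤ 2 * Z * s := by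
    have h1 : #W * (l * Z) ≤ 2 * m := by
      calc #W * (l * Z) = ∑ v ∈ W, l * Z := by rw [sum_const, smul_eq_mul]
        _ ≤ ∑ v ∈ W, #(neighborsIn Adj univ v) := sum_le_sum fun v hv => by
            simpa [W] using hv
        _ ≤ ∑ v, #(neighborsIn Adj univ v) := sum_le_sum_of_subset (subset_univ _)
        _ ≤ 2 * m := sum_card_neighborsIn_le univ
    refine Nat.le_of_mul_le_mul_left (c := l * Z) ?_ (by positivity)
    calc l * Z * (512 * q * #W) = 512 * q * (#W * (l * Z)) := by ring
      _ ≤ 512 * q * (2 * m) := by gcongr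
      _ = 2 * (512 * q * m) := by ring
      _ ≤ 2 * (Z ^ 2 * l * s) := by gcongr
      _ = _ := by ring
  have hhigh : HasLabeling Adj q W (q * (((2 * q) ^ q * (q + 1) + 1) * k) * s) := by
    have h1 := hasPartition_of_forall_exists (Adj := Adj) (q := q) hirr (W := W) (N := N)
      (A := (2 * q) ^ q * N) (s := s) hs
      (fun R hR hNR => exists_hasLabeling_of_edges_le hirr hanti hq hsb hl hqs hb hN hm
        (le_trans (by gcongr) hWcard) hNR) (l * (q + 1)) subset_rfl (by
        have h2 : #W ≤ Z * s := by nlinarith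
        calc #W ≤ Z * s := h2
          _ = s ^ (q + 1) * N := by rw [hZdef]; ring
          _ ≤ (2 ^ l) ^ (q + 1) * N := by gcongr
          _ = _ := by rw [pow_mul])
    refine (h1.mono ?_ le_rfl).hasLabeling hq
    set B := (2 * q) ^ q * (q + 1) + 1 with hB
    calc N + (2 * q) ^ q * N * (l * (q + 1))
        ≤ l * N + (2 * q) ^ q * N * (l * (q + 1)) := by
          gcongr
          exact Nat.le_mul_of_pos_left N hl
      _ = B * (l * N) := by rw [hB]; ring
      _ ≤ B ^ q * k ^ q := by
          gcongr
          exact Nat.le_self_pow (by omega) B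
      _ = (B * k) ^ q := by rw [mul_pow]
  have hlow : HasLabeling Adj q (univ \ W) (q * (k * s) * 1) := by
    refine (HasPartition.mono (hasPartition_of_degree_lt hirr (d := l * Z) ?_) ?_ le_rfl).hasLabeling
      hq
    · intro v hv
      simp only [W, mem_sdiff, mem_univ, mem_filter, true_and, not_le] at hv
      exact (card_le_card (filter_subset_filter _ (subset_univ _))).trans_lt hv
    · calc l * Z = l * N * s ^ q := by rw [hZdef]; ring
        _ ≤ k ^ q * s ^ q := by gcongr
        _ = _ := by rw [mul_pow]
  have h := hhigh.union hq hlow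
  rw [union_sdiff_of_subset (subset_univ _)] at h
  exact h.mono subset_rfl (le_of_eq (by ring))

end LabelingsAndPartitions

/-- Coloring every edge by a coordinate that it increases leaves only short monochromatic paths. -/
lemma HasLabeling.exists_coloring {V : Type} [Fintype V] {Adj : V → V → Prop} {q s n : ℕ}
    (h : HasLabeling Adj q Finset.univ s) (hs : s < n) :
    ∃ c : V → V → Fin (q + 1), ¬ ∃ p : Fin (n - 1 + 1) → V, IsDiPath Adj p ∧ IsMono c p := by
  classical
  obtain ⟨f, hf1, hf2⟩ := h
  refine ⟨fun u v => if h : ∃ i, f u i < f v i then h.choose else 0, ?_⟩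
  rintro ⟨p, ⟨-, hadj⟩, col, hcol⟩
  have hstep : ∀ i : Fin (n - 1), f (p i.castSucc) col < f (p i.succ) col := fun i => by
    have hex := hf2 _ (Finset.mem_univ _) _ (Finset.mem_univ _) (hadj i)
    have h1 := hcol i
    simp only [hex, dif_pos] at h1
    rw [← h1]
    exact hex.choose_spec
  have hle : ∀ i : Fin (n - 1 + 1), (i : ℕ) ≤ f (p i) col := by
    refine Fin.induction (Nat.zero_le _) fun i ih => ?_
    have h1 := hstep i
    simp only [Fin.val_castSucc, Fin.val_succ] at ih ⊢
    omega
  have hlast := hle (Fin.last (n - 1))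
  have hlt := hf1 (p (Fin.last (n - 1))) (Finset.mem_univ _) col
  rw [Fin.val_last] at hlast
  omega

lemma Nat.exists_forall_mul_sq_le_two_pow (K : ℕ) : ∃ m₀, ∀ m ≥ m₀, K * m ^ 2 ≤ 2 ^ m := by
  have h := (tendsto_pow_const_mul_const_pow_of_abs_lt_one 2
    (show |(1 / 2 : ℝ)| < 1 by norm_num [abs_of_pos])).const_mul (K : ℝ)
  rw [mul_zero] at h
  obtain ⟨m₀, hm₀⟩ := Filter.eventually_atTop.1 (h.eventually_lt_const one_pos)
  refine ⟨m₀, fun m hm => ?_⟩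
  have h1 := hm₀ m hm
  rw [one_div, inv_pow, ← mul_assoc, ← div_eq_mul_inv, div_lt_one (by positivity)] at h1
  exact_mod_cast h1.le

lemma exists_forall_log_bounds {K C : ℕ} (hC : 1 ≤ C) :
    ∃ L₀, ∀ L ≥ L₀, 1 ≤ L ∧ 16 * K * (Nat.log 2 L + 1) ^ 2 ≤ L ∧
      C * L ^ 2 * (8 * 2 ^ (L / 2)) + 1 ≤ 2 ^ L := by
  obtain ⟨m₁, hm₁⟩ := Nat.exists_forall_mul_sq_le_two_pow (2 * (16 * K))
  obtain ⟨m₂, hm₂⟩ := Nat.exists_forall_mul_sq_le_two_pow (C * 8 * 9)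
  have h0 : 0 < 2 ^ m₁ := by positivity
  refine ⟨2 ^ m₁ + 2 * m₂ + 2, fun L hL => ⟨by omega, ?_, ?_⟩⟩
  · have hlL : 2 ^ Nat.log 2 L ≤ L := Nat.pow_log_le_self 2 (by omega)
    have hl : m₁ ≤ Nat.log 2 L := Nat.le_log_of_pow_le one_lt_two (by omega)
    have hsq := hm₁ (Nat.log 2 L + 1) (by omega)
    rw [pow_succ 2] at hsq
    linarith
  · have h1 := hm₂ (L - L / 2) (by omega)
    have h2 : L + 1 ≤ 3 * (L - L / 2) := by omega
    have h3 : 1 ≤ C * (8 * 2 ^ (L / 2)) := Nat.mul_pos hC (by positivity)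
    calc C * L ^ 2 * (8 * 2 ^ (L / 2)) + 1
        ≤ C * L ^ 2 * (8 * 2 ^ (L / 2)) + C * (8 * 2 ^ (L / 2)) * (2 * L + 1) := by
          gcongr
          exact Nat.mul_pos h3 (Nat.succ_pos _)
      _ = C * 8 * (L + 1) ^ 2 * 2 ^ (L / 2) := by ring
      _ ≤ C * 8 * (3 * (L - L / 2)) ^ 2 * 2 ^ (L / 2) := by gcongr
      _ = C * 8 * 9 * (L - L / 2) ^ 2 * 2 ^ (L / 2) := by ring
      _ ≤ 2 ^ (L - L / 2) * 2 ^ (L / 2) := by gcongr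
      _ = 2 ^ L := by rw [← pow_add]; congr 1; omega

/-- The largest `s` with `s ^ q * l ≤ b`. -/
lemma exists_maximal_root {q l b : ℕ} (hq : 1 ≤ q) (hl : 1 ≤ l) (hb : q ^ q * l ≤ b) :
    ∃ s, s ^ q * l ≤ b ∧ q ≤ s ∧ s ≤ b ∧ b < (s + 1) ^ q * l := by
  have hle : ∀ s, s ^ q * l ≤ b → s ≤ b := fun s h =>
    ((Nat.le_self_pow (by omega) s).trans (Nat.le_mul_of_pos_right _ hl)).trans h
  have hspec := Nat.findGreatest_spec (P := fun s => s ^ q * l ≤ b) (hle q hb) hb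
  refine ⟨_, hspec, Nat.le_findGreatest (hle q hb) hb, hle _ hspec, ?_⟩
  by_contra! h
  have := Nat.le_findGreatest (P := fun s => s ^ q * l ≤ b) (hle _ h) h
  omega

lemma exists_labeling_parameters {q C : ℕ} (hq : 1 ≤ q) (hC : 1 ≤ C) :
    ∃ n₀, ∀ n ≥ n₀, ∃ s b N k, s ^ q * (Nat.log 2 (Nat.log 2 n) + 1) ≤ b ∧ q ≤ s ∧ 4 ≤ b ∧
      8 * ((b ^ 2 + 1) ^ b * 2 ^ b) ≤ N ∧ s ≤ 2 ^ (Nat.log 2 (Nat.log 2 n) + 1) ∧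
      (Nat.log 2 (Nat.log 2 n) + 1) * N ≤ k ^ q ∧ C * k * s < n ∧
      n ^ q ≤ (4 * C) ^ q * 2 * (Nat.log 2 (Nat.log 2 n) + 1) * (N * s ^ q) ∧
      Nat.log 2 n ≤ 32 * 2 ^ q * s ^ q * (Nat.log 2 (Nat.log 2 n) + 1) ^ 2 := by
  obtain ⟨L₀, hL₀⟩ := exists_forall_log_bounds (K := q ^ q + 4) hC
  refine ⟨2 ^ L₀, fun n hn => ?_⟩
  have hn0 : 0 < n := lt_of_lt_of_le (by positivity) hn
  have hLn : 2 ^ Nat.log 2 n ≤ n := Nat.pow_log_le_self 2 hn0.ne'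
  obtain ⟨hL1, hsq, hLbig⟩ := hL₀ (Nat.log 2 n) (Nat.le_log_of_pow_le one_lt_two hn)
  generalize Nat.log 2 n = L at *
  have hlL : Nat.log 2 L + 1 ≤ L :=
    Nat.lt_two_pow_self.trans_le (Nat.pow_log_le_self 2 (by omega))
  have hLl : L < 2 ^ (Nat.log 2 L + 1) := Nat.lt_pow_succ_log_self one_lt_two L
  have hl1 : 1 ≤ Nat.log 2 L + 1 := Nat.succ_pos _
  generalize Nat.log 2 L + 1 = l at *
  obtain ⟨b, hb⟩ : ∃ b, b = L / (16 * l) := ⟨_, rfl⟩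
  have hbL : 16 * l * b ≤ L := hb ▸ Nat.mul_div_le _ _
  have hLb : L < 16 * l * (b + 1) := hb ▸ Nat.lt_mul_div_succ L (by positivity)
  have hb_le : b ≤ L := hb ▸ Nat.div_le_self _ _
  have hqb : (q ^ q + 4) * l ≤ b := by
    rw [hb, Nat.le_div_iff_mul_le (by positivity)]
    linarith
  have hb4 : 4 ≤ b := by nlinarith [Nat.zero_le (q ^ q * l)]
  obtain ⟨s, hsb, hqs, hs_le, hbs⟩ := exists_maximal_root hq hl1 (b := b) (by linarith)
  have hs : 0 < s := by omega
  have hCs : 0 < C * s := by positivity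
  obtain ⟨k, hk⟩ : ∃ k, k = (n - 1) / (C * s) := ⟨_, rfl⟩
  have hkn : C * s * k ≤ n - 1 := hk ▸ Nat.mul_div_le _ _
  have hnk : n - 1 < C * s * (k + 1) := hk ▸ Nat.lt_mul_div_succ _ hCs
  have hTk : 8 * 2 ^ (L / 2) * l ≤ k := by
    rw [hk, Nat.le_div_iff_mul_le hCs]
    have h1 : 8 * 2 ^ (L / 2) * l * (C * s) ≤ C * L ^ 2 * (8 * 2 ^ (L / 2)) := by
      calc 8 * 2 ^ (L / 2) * l * (C * s) ≤ 8 * 2 ^ (L / 2) * L * (C * L) := by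
            gcongr
            omega
        _ = _ := by ring
    omega
  have hk1 : 1 ≤ k := lt_of_lt_of_le (by positivity) hTk
  obtain ⟨N, hN⟩ : ∃ N, N = k ^ q / l := ⟨_, rfl⟩
  have hT : 8 * 2 ^ (L / 2) ≤ N := by
    rw [hN, Nat.le_div_iff_mul_le hl1]
    exact hTk.trans (Nat.le_self_pow (by omega) k)
  have hN1 : 1 ≤ N := lt_of_lt_of_le (by positivity) hT
  have hkN : k ^ q < l * (N + 1) := hN ▸ Nat.lt_mul_div_succ _ hl1
  refine ⟨s, b, N, k, hsb, hqs, hb4, ?_, by omega, hN ▸ Nat.mul_div_le _ _, ?_, ?_, ?_⟩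
  · refine le_trans ?_ hT
    gcongr
    have h1 : b ^ 2 + 1 ≤ 2 ^ (2 * l) := by
      rw [mul_comm, pow_mul]
      calc b ^ 2 + 1 ≤ (b + 1) ^ 2 := by linarith [add_sq b 1]
        _ ≤ _ := by
          gcongr
          omega
    calc (b ^ 2 + 1) ^ b * 2 ^ b ≤ (2 ^ (2 * l)) ^ b * 2 ^ b := by gcongr
      _ = 2 ^ (2 * l * b + b) := by rw [← pow_mul, pow_add]
      _ ≤ 2 ^ (L / 2) := by
        refine Nat.pow_le_pow_right two_pos ?_
        rw [Nat.le_div_iff_mul_le two_pos]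
        nlinarith
  · calc C * k * s = C * s * k := by ring
      _ ≤ n - 1 := hkn
      _ < n := by omega
  · have h1 : n ≤ 4 * C * s * k := by
      calc n ≤ C * s * (k + 1) := by omega
        _ ≤ C * s * (4 * k) := by gcongr; omega
        _ = _ := by ring
    have h2 : k ^ q ≤ 2 * l * N := by
      calc k ^ q ≤ l * (N + 1) := hkN.le
        _ ≤ l * (2 * N) := by gcongr; omega
        _ = _ := by ring
    calc n ^ q ≤ (4 * C * s * k) ^ q := by gcongr
      _ = (4 * C) ^ q * s ^ q * k ^ q := by rw [mul_pow, mul_pow]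
      _ ≤ (4 * C) ^ q * s ^ q * (2 * l * N) := by gcongr
      _ = _ := by ring
  · calc L ≤ 16 * l * (b + b) := by
          refine hLb.le.trans ?_
          gcongr
          omega
      _ = 32 * l * b := by ring
      _ ≤ 32 * l * ((s + s) ^ q * l) := by
          gcongr
          refine hbs.le.trans ?_
          gcongr
          omega
      _ = 32 * 2 ^ q * s ^ q * l ^ 2 := by rw [← two_mul, mul_pow]; ring

lemma logb_rpow_div_le {q n s : ℕ} (hq : 1 ≤ q) (hn : 4 ≤ n)
    (h : Nat.log 2 n ≤ 32 * 2 ^ q * s ^ q * (Nat.log 2 (Nat.log 2 n) + 1) ^ 2) :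
    (Real.logb 2 n) ^ ((1 : ℝ) / q) / (Real.logb 2 (Real.logb 2 n)) ^ (((q : ℝ) + 2) / q) ≤
      1024 * s / (Nat.log 2 (Nat.log 2 n) + 1 : ℕ) := by
  have hL2 : 2 ≤ Nat.log 2 n := Nat.le_log_of_pow_le one_lt_two hn
  have hLr : (Nat.log 2 n : ℝ) ≤ Real.logb 2 n := by exact_mod_cast Real.natLog_le_logb n 2
  have hrL : Real.logb 2 n ≤ 2 * Nat.log 2 n := by
    have h1 : Real.logb 2 n < Nat.log 2 n + 1 := by
      rw [Real.logb_lt_iff_lt_rpow one_lt_two (by positivity)]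
      exact_mod_cast Nat.lt_pow_succ_log_self one_lt_two n
    have h2 : (2 : ℝ) ≤ Nat.log 2 n := by exact_mod_cast hL2
    linarith
  set L := Nat.log 2 n with hLdef
  set x := Real.logb 2 n with hx
  have hx2 : 2 ≤ x := le_trans (by exact_mod_cast hL2) hLr
  have hy1 : 1 ≤ Real.logb 2 x := by
    rw [Real.le_logb_iff_rpow_le one_lt_two (by linarith)]
    simpa using hx2
  have hly : ((Nat.log 2 L + 1 : ℕ) : ℝ) ≤ 2 * Real.logb 2 x := by
    have h1 : (Nat.log 2 L : ℝ) ≤ Real.logb 2 L := by exact_mod_cast Real.natLog_le_logb L 2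
    have h2 : Real.logb 2 L ≤ Real.logb 2 x :=
      Real.logb_le_logb_of_le one_lt_two (by positivity) hLr
    push_cast
    linarith
  set l := Nat.log 2 L + 1 with hl
  set y := Real.logb 2 x with hy
  have hl0 : (0 : ℝ) < l := by positivity
  have hq0 : (q : ℝ) ≠ 0 := by positivity
  have hroot : x ^ ((1 : ℝ) / q) / y ^ (((q : ℝ) + 2) / q) = (x / y ^ (q + 2)) ^ ((1 : ℝ) / q) := by
    rw [Real.div_rpow (by linarith) (by positivity), ← Real.rpow_natCast y (q + 2),
      ← Real.rpow_mul (by linarith)]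
    congr 2
    push_cast
    ring
  rw [hroot, one_div, Real.rpow_inv_le_iff_of_pos (by positivity) (by positivity) (by positivity),
    Real.rpow_natCast, div_le_iff₀ (by positivity), div_pow, mul_pow, div_mul_eq_mul_div,
    le_div_iff₀ (by positivity)]
  have hR : (L : ℝ) ≤ 32 * 2 ^ q * s ^ q * (l : ℝ) ^ 2 := by exact_mod_cast h
  have h1024 : (2 : ℝ) ^ q * 2 ^ q * 256 ≤ 1024 ^ q := by
    obtain ⟨p, rfl⟩ := Nat.exists_eq_add_of_le' hq
    have h4 : (2 : ℝ) ^ p * 2 ^ p = 4 ^ p := by rw [← mul_pow]; norm_num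
    have h5 : (4 : ℝ) ^ p ≤ 1024 ^ p := by gcongr; norm_num
    calc (2 : ℝ) ^ (p + 1) * 2 ^ (p + 1) * 256 = 1024 * (2 ^ p * 2 ^ p) := by ring
      _ ≤ 1024 * 1024 ^ p := by rw [h4]; gcongr
      _ = _ := by ring
  calc x * (l : ℝ) ^ q ≤ 2 * (32 * 2 ^ q * s ^ q * (l : ℝ) ^ 2) * (l : ℝ) ^ q := by
        gcongr
        linarith
    _ = 64 * 2 ^ q * s ^ q * (l : ℝ) ^ (q + 2) := by ring
    _ ≤ 64 * 2 ^ q * s ^ q * (2 * y) ^ (q + 2) := by gcongr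
    _ = 2 ^ q * 2 ^ q * 256 * s ^ q * y ^ (q + 2) := by ring
    _ ≤ 1024 ^ q * s ^ q * y ^ (q + 2) := by gcongr

/-- For every `q ≥ 1` there are `c₁ > 0` and `n₀` such that for all `n ≥ n₀`,
every oriented graph with at most `c₁ · n^{2q} · (log n)^{1/q} / (log log n)^{(q+2)/q}`
edges admits a `(q+1)`-coloring of its edges with no monochromatic directed path on
`n` vertices (i.e. with `n - 1` edges). Logarithms are base 2. -/
theorem stmt_0 (q : ℕ) (hq : 1 ≤ q) :
    ∃ (c₁ : ℝ) (n₀ : ℕ), 0 < c₁ ∧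
      ∀ n : ℕ, n₀ ≤ n →
        ∀ (V : Type) (_ : Fintype V) (Adj : V → V → Prop), IsOriented Adj →
          (({e : V × V | Adj e.1 e.2}.ncard : ℝ) ≤
            c₁ * (n : ℝ) ^ (2 * q) * (Real.logb 2 n) ^ ((1 : ℝ) / q) /
              (Real.logb 2 (Real.logb 2 n)) ^ (((q : ℝ) + 2) / q)) →
          ∃ c : V → V → Fin (q + 1),
            ¬ ∃ p : Fin (n - 1 + 1) → V, IsDiPath Adj p ∧ IsMono c p := by
  classical
  set C := q * ((2 * q) ^ q * (q + 1) + 2) with hC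
  have hC1 : 1 ≤ C := Nat.mul_pos hq (by positivity)
  obtain ⟨n₀, hn₀⟩ := exists_labeling_parameters hq hC1
  refine ⟨1 / (512 * q * 1024 * 4 * (4 * C) ^ (2 * q)), max n₀ 4, by positivity, ?_⟩
  intro n hn V _ Adj hG hcard
  obtain ⟨s, b, N, k, hsb, hqs, hb, hN, hbl, hk, hlt, hnN, hlog⟩ :=
    hn₀ n ((le_max_left _ _).trans hn)
  have hratio := logb_rpow_div_le hq ((le_max_right _ _).trans hn) hlog
  set l := Nat.log 2 (Nat.log 2 n) + 1 with hl
  refine HasLabeling.exists_coloring (hasLabeling_univ_of_edges_le (fun v => hG.1 v) hG.2 hq hsb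
    (Nat.succ_pos _) hqs hb hN hbl hk ?_) hlt
  have hset : {e : V × V | Adj e.1 e.2}.ncard =
      Finset.card (Finset.univ.filter fun e : V × V => Adj e.1 e.2) := by
    rw [← Set.ncard_coe_finset]
    simp
  rw [hset, mul_div_assoc] at hcard
  have hnN' : (n : ℝ) ^ q ≤ (4 * C) ^ q * 2 * l * (N * s ^ q) := by exact_mod_cast hnN
  have hl0 : (0 : ℝ) < l := by positivity
  have key : 512 * (q : ℝ) * (Finset.card (Finset.univ.filter fun e : V × V => Adj e.1 e.2)) ≤
      ((N : ℝ) * s ^ q) ^ 2 * l * s := by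
    calc 512 * (q : ℝ) * (Finset.card (Finset.univ.filter fun e : V × V => Adj e.1 e.2))
        ≤ 512 * q * (1 / (512 * q * 1024 * 4 * (4 * C) ^ (2 * q)) * (n : ℝ) ^ (2 * q) *
            (1024 * s / l)) := by
          gcongr
          exact hcard.trans (by gcongr)
      _ = ((n : ℝ) ^ q) ^ 2 * s / (4 * l * ((4 * C) ^ q) ^ 2) := by
          rw [← pow_mul, ← pow_mul, mul_comm q 2]
          field_simp
      _ ≤ ((4 * C) ^ q * 2 * l * (N * s ^ q)) ^ 2 * s / (4 * l * ((4 * C) ^ q) ^ 2) := by gcongr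
      _ = _ := by
          field_simp
          ring
  convert (by exact_mod_cast key : 512 * q *
    Finset.card (Finset.univ.filter fun e : V × V => Adj e.1 e.2) ≤ (N * s ^ q) ^ 2 * l * s)
end

section
/- There exists a real constant c₂ > 0 such that for every integer q ≥ 1 there is a natural number n₀ with the following property: for every n ≥ n₀ there exists an oriented graph G on a finite vertex type with at most c₂ · n^{2q} · (log n)² edges such that every (q+1)-coloring of the edges of G contains a monochromatic directed path on n vertices. -/
/-- A list of distinct vertices of `A` in which consecutive vertices are related by `R`. -/
structure IsPathIn {V : Type} (R : V → V → Prop) (A : Finset V) (l : List V) : Prop where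
  chain : l.IsChain R
  nodup : l.Nodup
  mem : ∀ x ∈ l, x ∈ A

section Paths

variable {V : Type} {R : V → V → Prop} {A B : Finset V} {l : List V}

theorem IsPathIn.mono (h : IsPathIn R A l) (hAB : A ⊆ B) : IsPathIn R B l :=
  ⟨h.chain, h.nodup, fun x hx => hAB (h.mem x hx)⟩

theorem IsPathIn.of_infix {l' : List V} (h : IsPathIn R A l) (hl : l' <:+: l) :
    IsPathIn R A l' :=
  ⟨h.chain.infix hl, h.nodup.sublist hl.sublist, fun x hx => h.mem x (hl.subset hx)⟩

theorem IsPathIn.length_le_card (h : IsPathIn R A l) : l.length ≤ A.card := by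
  classical
  rw [← List.toFinset_card_of_nodup h.nodup]
  exact Finset.card_le_card fun x hx => h.mem x (List.mem_toFinset.1 hx)

theorem IsPathIn.nil (R : V → V → Prop) (A : Finset V) : IsPathIn R A [] :=
  ⟨List.isChain_nil, List.nodup_nil, by simp⟩

/-- The largest number of vertices of a path of `R` inside `A`. -/
noncomputable def longestPath {V : Type} (R : V → V → Prop) (A : Finset V) : ℕ :=
  sSup {m | ∃ l, IsPathIn R A l ∧ l.length = m}

theorem bddAbove_pathLengths (R : V → V → Prop) (A : Finset V) :
    BddAbove {m | ∃ l, IsPathIn R A l ∧ l.length = m} :=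
  ⟨A.card, by rintro _ ⟨l, hl, rfl⟩; exact hl.length_le_card⟩

theorem IsPathIn.length_le_longestPath (h : IsPathIn R A l) : l.length ≤ longestPath R A :=
  le_csSup (bddAbove_pathLengths R A) ⟨l, h, rfl⟩

theorem exists_length_eq_longestPath (R : V → V → Prop) (A : Finset V) :
    ∃ l, IsPathIn R A l ∧ l.length = longestPath R A :=
  Nat.sSup_mem (s := {m | ∃ l, IsPathIn R A l ∧ l.length = m})
    ⟨0, [], IsPathIn.nil R A, rfl⟩ (bddAbove_pathLengths R A)

/-- A state of depth-first search in `S`: the finished vertices `F`, the stack `P` (top first)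
and the unvisited vertices `U`. -/
structure IsSearchState (R : V → V → Prop) (S F U : Finset V) (P : List V) : Prop where
  stack : IsPathIn (fun x y => R y x) S P
  finished_subset : F ⊆ S
  unvisited_subset : U ⊆ S
  disjoint : Disjoint F U
  stack_notMem : ∀ x ∈ P, x ∉ F ∧ x ∉ U
  card_eq : F.card + P.length + U.card = S.card
  no_edge : ∀ u ∈ F, ∀ v ∈ U, ¬ R u v

theorem IsSearchState.length_le {S F U : Finset V} {P : List V} (h : IsSearchState R S F U P) :
    P.length ≤ longestPath R S := by
  have : IsPathIn R S P.reverse :=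
    ⟨List.isChain_reverse.2 h.stack.chain, List.nodup_reverse.2 h.stack.nodup,
      fun x hx => h.stack.mem x (List.mem_reverse.1 hx)⟩
  simpa using this.length_le_longestPath

theorem IsSearchState.push [DecidableEq V] {S F U : Finset V} {P : List V} {y : V}
    (h : IsSearchState R S F U P) (hy : y ∈ U) (hP : ∀ t ∈ P.head?, R t y) :
    IsSearchState R S F (U.erase y) (y :: P) where
  stack := ⟨List.isChain_cons.2 ⟨hP, h.stack.chain⟩,
    List.nodup_cons.2 ⟨fun hyP => (h.stack_notMem y hyP).2 hy, h.stack.nodup⟩, by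
      intro x hx
      rcases List.mem_cons.1 hx with rfl | hx
      · exact h.unvisited_subset hy
      · exact h.stack.mem x hx⟩
  finished_subset := h.finished_subset
  unvisited_subset := (Finset.erase_subset _ _).trans h.unvisited_subset
  disjoint := h.disjoint.mono_right (Finset.erase_subset _ _)
  stack_notMem := by
    intro x hx
    rcases List.mem_cons.1 hx with rfl | hx
    · exact ⟨fun hF => Finset.disjoint_left.1 h.disjoint hF hy, Finset.notMem_erase _ _⟩
    · exact ⟨(h.stack_notMem x hx).1, fun hU =>
        (h.stack_notMem x hx).2 (Finset.mem_of_mem_erase hU)⟩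
  card_eq := by
    have := h.card_eq
    have := Finset.card_erase_add_one hy
    simp only [List.length_cons]
    omega
  no_edge := fun u hu v hv => h.no_edge u hu v (Finset.mem_of_mem_erase hv)

theorem IsSearchState.pop [DecidableEq V] {S F U : Finset V} {P : List V} {t : V}
    (h : IsSearchState R S F U (t :: P)) (ht : ∀ y ∈ U, ¬ R t y) :
    IsSearchState R S (insert t F) U P where
  stack := h.stack.of_infix (List.suffix_cons t P).isInfix
  finished_subset := Finset.insert_subset (h.stack.mem t (by simp)) h.finished_subset
  unvisited_subset := h.unvisited_subset
  disjoint := Finset.disjoint_insert_left.2 ⟨(h.stack_notMem t (by simp)).2, h.disjoint⟩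
  stack_notMem := by
    intro x hx
    have h1 := h.stack_notMem x (by simp [hx])
    refine ⟨fun hF => ?_, h1.2⟩
    rcases Finset.mem_insert.1 hF with rfl | hF
    · exact (List.nodup_cons.1 h.stack.nodup).1 hx
    · exact h1.1 hF
  card_eq := by
    have := h.card_eq
    rw [Finset.card_insert_of_notMem (h.stack_notMem t (by simp)).1]
    simp only [List.length_cons] at this
    omega
  no_edge := by
    intro u hu v hv
    rcases Finset.mem_insert.1 hu with rfl | hu
    · exact ht v hv
    · exact h.no_edge u hu v hv

theorem IsSearchState.exists_card_succ {S F U : Finset V} {P : List V}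
    (h : IsSearchState R S F U P) (hF : F.card < S.card) :
    ∃ F' U' P', IsSearchState R S F' U' P' ∧ F'.card = F.card + 1 := by
  classical
  induction hm : U.card generalizing U P with
  | zero =>
    obtain rfl : U = ∅ := Finset.card_eq_zero.1 hm
    cases P with
    | nil => have := h.card_eq; simp at this; omega
    | cons t P =>
      exact ⟨_, _, _, h.pop (by simp),
        Finset.card_insert_of_notMem (h.stack_notMem t (by simp)).1⟩
  | succ m ih =>
    have hpush : ∀ y ∈ U, (∀ t ∈ P.head?, R t y) →
        ∃ F' U' P', IsSearchState R S F' U' P' ∧ F'.card = F.card + 1 := fun y hy hP =>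
      ih (h.push hy hP) (by rw [Finset.card_erase_of_mem hy, hm]; rfl)
    cases P with
    | nil =>
      obtain ⟨y, hy⟩ : U.Nonempty := Finset.card_pos.1 (by omega)
      exact hpush y hy (by simp)
    | cons t P =>
      by_cases ht : ∃ y ∈ U, R t y
      · obtain ⟨y, hy, hty⟩ := ht
        exact hpush y hy (by simpa using hty)
      · push Not at ht
        exact ⟨_, _, _, h.pop ht, Finset.card_insert_of_notMem (h.stack_notMem t (by simp)).1⟩

theorem exists_isSearchState (R : V → V → Prop) (S : Finset V) {a : ℕ} (ha : a ≤ S.card) :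
    ∃ F U P, IsSearchState R S F U P ∧ F.card = a := by
  induction a with
  | zero =>
    exact ⟨∅, S, [], ⟨IsPathIn.nil _ _, by simp, subset_rfl, by simp, by simp, by simp, by simp⟩,
      rfl⟩
  | succ a ih =>
    obtain ⟨F, U, P, h, rfl⟩ := ih (by omega)
    exact h.exists_card_succ (by omega)

/-- Levels for a digraph without long paths: adjacent vertices get distinct levels
(the Gallai–Roy theorem). -/
theorem exists_proper_coloring_of_longestPath_le [Fintype V] {p : ℕ} (hR : ∀ v, ¬ R v v)
    (h : ∀ l : List V, l.IsChain R → l.Nodup → l.length ≤ p) :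
    ∃ f : V → Fin p, ∀ u v, R u v → f u ≠ f v := by
  classical
  let valid : (V → ℕ) → Prop := fun f => ∀ v, f v ≠ 0 → ∃ u, R u v ∧ f v = f u + 1
  have path : ∀ f, valid f → ∀ m v, f v = m → ∃ l : List V,
      l.IsChain (fun y x => R x y ∧ f y = f x + 1) ∧ l.head? = some v ∧ l.length = m + 1 := by
    intro f hf m
    induction m with
    | zero => intro v _; exact ⟨[v], by simp, rfl, rfl⟩
    | succ m ih =>
      intro v hv
      obtain ⟨u, hu, huv⟩ := hf v (by omega)
      obtain ⟨l, h1, h2, h3⟩ := ih u (by omega)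
      refine ⟨v :: l, List.isChain_cons.2 ⟨?_, h1⟩, rfl, by simp [h3]⟩
      intro y hy
      rw [h2] at hy
      obtain rfl : u = y := by simpa using hy
      exact ⟨hu, huv⟩
  have bound : ∀ f, valid f → ∀ v, f v < p := by
    intro f hf v
    obtain ⟨l, h1, h2, h3⟩ := path f hf _ v rfl
    have hch : l.reverse.IsChain R :=
      List.isChain_reverse.2 (h1.imp fun _ _ hxy => hxy.1)
    have hnd : l.Nodup := by
      have : (l.map f).IsChain (· > ·) := by
        rw [List.isChain_map]
        exact h1.imp fun x y hxy => by omega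
      have hnd : (l.map f).Nodup :=
        List.Pairwise.imp (fun h => ne_of_gt h) (List.isChain_iff_pairwise.1 this)
      exact hnd.of_map
    have := h _ hch (List.nodup_reverse.2 hnd)
    simp at this
    omega
  let T : Set ℕ := {s | ∃ f, valid f ∧ ∑ v, f v = s}
  have hT : BddAbove T := by
    refine ⟨∑ _v : V, p, ?_⟩
    rintro _ ⟨f, hf, rfl⟩
    exact Finset.sum_le_sum fun v _ => (bound f hf v).le
  obtain ⟨f, hf, hfs⟩ := Nat.sSup_mem (s := T) ⟨_, fun _ => 0, fun v hv => absurd rfl hv, rfl⟩ hT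
  refine ⟨fun v => ⟨f v, bound f hf v⟩, fun u v huv heq => ?_⟩
  have heq : f u = f v := by simpa using heq
  let W : V → Prop := Relation.ReflTransGen (fun x y => R x y ∧ f y = f x + 1) v
  have hW : ∀ w, W w → w = v ∨ f v < f w := by
    intro w hw
    induction hw with
    | refl => exact Or.inl rfl
    | tail _ hxy ih => rcases ih with rfl | ih <;> right <;> omega
  let g : V → ℕ := fun w => if W w then f w + 1 else f w
  have hg : valid g := by
    intro w hw
    by_cases hWw : W w
    · rcases Relation.ReflTransGen.cases_tail hWw with rfl | ⟨x, hx, hxw⟩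
      · refine ⟨u, huv, ?_⟩
        have hu : ¬ W u := fun hu => by
          rcases hW u hu with rfl | hlt
          · exact hR _ huv
          · omega
        simp [g, hWw, hu, heq]
      · refine ⟨x, hxw.1, ?_⟩
        have hx' : W x := hx
        simp [g, hWw, hx', hxw.2]
    · have : f w ≠ 0 := by simpa [g, hWw] using hw
      obtain ⟨x, hx, hxw⟩ := hf w this
      refine ⟨x, hx, ?_⟩
      have hx' : ¬ W x := fun hx' => hWw (Relation.ReflTransGen.tail hx' ⟨hx, hxw⟩)
      simp [g, hWw, hx', hxw]
  have hlt : ∑ w, f w < ∑ w, g w := by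
    refine Finset.sum_lt_sum (fun w _ => ?_) ⟨v, Finset.mem_univ _, ?_⟩
    · by_cases hWw : W w <;> simp [g, hWw]
    · have : W v := Relation.ReflTransGen.refl
      simp [g, this]
  have := le_csSup hT ⟨g, hg, rfl⟩
  omega

end Paths

section Colored

variable {V : Type} {Adj R Q : V → V → Prop} {k : ℕ}

/-- Any two disjoint sets of at least `k` vertices are joined by edges in both directions. -/
def IsPseudorandom (Adj : V → V → Prop) (k : ℕ) : Prop :=
  ∀ A B : Finset V, Disjoint A B → k ≤ A.card → k ≤ B.card → ∃ a ∈ A, ∃ b ∈ B, Adj a b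

/-- Disjoint sets `A`, `B` such that edges from `A` to `B` lie in `R` and edges from `B` to `A`
lie in `Q`. -/
def IsSplit (Adj R Q : V → V → Prop) (A B : Finset V) : Prop :=
  Disjoint A B ∧ ∀ u ∈ A, ∀ v ∈ B, (Adj u v → R u v) ∧ (Adj v u → Q v u)

theorem IsSplit.swap {A B : Finset V} (h : IsSplit Adj R Q A B) : IsSplit Adj Q R B A :=
  ⟨h.1.symm, fun u hu v hv => (h.2 v hv u hu).symm⟩

theorem IsSplit.mono {A B A' B' : Finset V} (h : IsSplit Adj R Q A B) (hA : A' ⊆ A)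
    (hB : B' ⊆ B) : IsSplit Adj R Q A' B' :=
  ⟨h.1.mono hA hB, fun u hu v hv => h.2 u (hA hu) v (hB hv)⟩

/-- A set without long monochromatic paths contains two halves split by the two colors. -/
theorem exists_isSplit (hk : IsPseudorandom Adj k) {S : Finset V}
    (hS : ∀ u ∈ S, ∀ v ∈ S, Adj u v → R u v ∨ Q u v) {h : ℕ}
    (hcard : 2 * h + 2 * (longestPath R S + longestPath Q S) + 2 * k ≤ S.card) :
    ∃ A B, A ⊆ S ∧ B ⊆ S ∧ A.card = h ∧ B.card = h ∧ IsSplit Adj R Q A B := by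
  classical
  obtain ⟨A, B, P, hAB, hA⟩ := exists_isSearchState Q S
    (a := h + k + longestPath R S) (by omega)
  have hP := hAB.length_le
  have hc := hAB.card_eq
  have hABS : A ∪ B ⊆ S := Finset.union_subset hAB.finished_subset hAB.unvisited_subset
  have hcu : (A ∪ B).card = A.card + B.card := Finset.card_union_of_disjoint hAB.disjoint
  obtain ⟨F, U, P', hFU, hF⟩ := exists_isSearchState R (A ∪ B) (a := h + k) (by omega)
  have hP' : P'.length ≤ longestPath R S := by
    refine hFU.length_le.trans ?_
    obtain ⟨l, hl, hll⟩ := exists_length_eq_longestPath R (A ∪ B)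
    rw [← hll]
    exact (hl.mono hABS).length_le_longestPath
  have hc' := hFU.card_eq
  have hsplit : IsSplit Adj R Q (U ∩ A) (F ∩ B) := by
    refine ⟨(hFU.disjoint.symm).mono Finset.inter_subset_left Finset.inter_subset_left, ?_⟩
    intro u hu v hv
    simp only [Finset.mem_inter] at hu hv
    have huS := hAB.finished_subset hu.2
    have hvS := hAB.unvisited_subset hv.2
    exact ⟨fun huv => (hS u huS v hvS huv).resolve_right (hAB.no_edge u hu.2 v hv.2),
      fun hvu => (hS v hvS u huS hvu).resolve_left (hFU.no_edge v hv.1 u hu.1)⟩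
  have key : (F ∩ A).card < k ∨ (U ∩ B).card < k := by
    by_contra! hcon
    obtain ⟨a, ha, b, hb, hab⟩ := hk (F ∩ A) (U ∩ B)
      (hFU.disjoint.mono Finset.inter_subset_left Finset.inter_subset_left) hcon.1 hcon.2
    simp only [Finset.mem_inter] at ha hb
    rcases hS a (hAB.finished_subset ha.2) b (hAB.unvisited_subset hb.2) hab with hR | hQ
    · exact hFU.no_edge a ha.1 b hb.1 hR
    · exact hAB.no_edge a ha.2 b hb.2 hQ
  have part : ∀ X ⊆ A ∪ B, (X ∩ A).card + (X ∩ B).card = X.card := by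
    intro X hX
    rw [← Finset.card_union_of_disjoint
      (hAB.disjoint.mono Finset.inter_subset_right Finset.inter_subset_right),
      ← Finset.inter_union_distrib_left, Finset.inter_eq_left.2 hX]
  have hFp := part F hFU.finished_subset
  have hUp := part U hFU.unvisited_subset
  have cover : ∀ X ⊆ A ∪ B, X.card ≤ (F ∩ X).card + (U ∩ X).card + P'.length := by
    intro X hX
    have h1 : ((F ∪ U) ∪ X).card ≤ (A ∪ B).card :=
      Finset.card_le_card (Finset.union_subset
        (Finset.union_subset hFU.finished_subset hFU.unvisited_subset) hX)
    have h2 := Finset.card_union_add_card_inter (F ∪ U) X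
    have h3 : (F ∪ U).card = F.card + U.card := Finset.card_union_of_disjoint hFU.disjoint
    have h4 : ((F ∪ U) ∩ X).card ≤ (F ∩ X).card + (U ∩ X).card := by
      rw [Finset.union_inter_distrib_right]
      exact Finset.card_union_le _ _
    omega
  have hcA := cover A Finset.subset_union_left
  have hcB := cover B Finset.subset_union_right
  have hbig : h ≤ (U ∩ A).card ∧ h ≤ (F ∩ B).card := by
    rcases key with key | key <;> constructor <;> omega
  obtain ⟨A', hA', hA'c⟩ := Finset.exists_subset_card_eq hbig.1
  obtain ⟨B', hB', hB'c⟩ := Finset.exists_subset_card_eq hbig.2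
  exact ⟨A', B', (hA'.trans Finset.inter_subset_right).trans hAB.finished_subset,
    (hB'.trans Finset.inter_subset_right).trans hAB.unvisited_subset, hA'c, hB'c,
    hsplit.mono hA' hB'⟩

/-- A set `A` with exits `I` such that any exits but fewer than `k` are reached, by paths of `R`
with at least `w` vertices, from at least `k` entrances. -/
def IsGadget (R : V → V → Prop) (k : ℕ) (A : Finset V) (w : ℕ) : Prop :=
  ∃ I ⊆ A, ∀ I' ⊆ I, I.card < I'.card + k → ∃ O ⊆ A, k ≤ O.card ∧
    ∀ o ∈ O, ∃ l, IsPathIn R A l ∧ l.head? = some o ∧ (∃ i ∈ I', l.getLast? = some i) ∧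
      w ≤ l.length

/-- Gadgets of a list with all forward edges in `R` can be concatenated. -/
theorem exists_entrances (hk : IsPseudorandom Adj k) (hk0 : 0 < k) (w : Finset V → ℕ)
    (L : List (Finset V)) (hL : L ≠ []) (hg : ∀ A ∈ L, IsGadget R k A (w A))
    (hs : L.Pairwise (IsSplit Adj R Q)) :
    ∃ O : Finset V, k ≤ O.card ∧ ∀ o ∈ O, ∃ l : List V, l.IsChain R ∧ l.Nodup ∧
      (∀ x ∈ l, ∃ A ∈ L, x ∈ A) ∧ l.head? = some o ∧ (L.map w).sum ≤ l.length := by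
  classical
  induction L with
  | nil => exact absurd rfl hL
  | cons A L ih =>
    obtain ⟨I, hIA, hI⟩ := hg A (by simp)
    rcases eq_or_ne L [] with rfl | hL'
    · obtain ⟨O, -, hO, hOp⟩ := hI I subset_rfl (by omega)
      refine ⟨O, hO, fun o ho => ?_⟩
      obtain ⟨l, hl, h1, -, h3⟩ := hOp o ho
      exact ⟨l, hl.chain, hl.nodup, fun x hx => ⟨A, by simp, hl.mem x hx⟩, h1, by simpa using h3⟩
    · rw [List.pairwise_cons] at hs
      obtain ⟨O, hO, hOp⟩ := ih hL' (fun B hB => hg B (by simp [hB])) hs.2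
      have hOL : ∀ o ∈ O, ∃ B ∈ L, o ∈ B := by
        intro o ho
        obtain ⟨l, -, -, hm, hh, -⟩ := hOp o ho
        exact hm o (List.mem_of_mem_head? hh)
      have hdisj : ∀ x ∈ A, ∀ B ∈ L, x ∉ B := fun x hx B hB =>
        Finset.disjoint_left.1 (hs.1 B hB).1 hx
      let I' := I.filter fun i => ∃ o ∈ O, Adj i o
      have hI' : I.card < I'.card + k := by
        by_contra! hcon
        have hsd : (I \ I').card = I.card - I'.card :=
          Finset.card_sdiff_of_subset (Finset.filter_subset _ _)
        obtain ⟨a, ha, b, hb, hab⟩ := hk (I \ I') O (by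
          refine Finset.disjoint_left.2 fun x hx hxO => ?_
          obtain ⟨B, hB, hxB⟩ := hOL x hxO
          exact hdisj x (hIA (Finset.mem_sdiff.1 hx).1) B hB hxB) (by omega) hO
        rw [Finset.mem_sdiff] at ha
        exact ha.2 (Finset.mem_filter.2 ⟨ha.1, b, hb, hab⟩)
      obtain ⟨O', -, hO', hOp'⟩ := hI I' (Finset.filter_subset _ _) hI'
      refine ⟨O', hO', fun o' ho' => ?_⟩
      obtain ⟨l, hl, hlh, ⟨i, hi, hli⟩, hlw⟩ := hOp' o' ho'
      obtain ⟨hiI, o, ho, hio⟩ := Finset.mem_filter.1 hi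
      obtain ⟨l', hc', hn', hm', hh', hw'⟩ := hOp o ho
      refine ⟨l ++ l', List.isChain_append.2 ⟨hl.chain, hc', ?_⟩, ?_, ?_, ?_, ?_⟩
      · intro x hx y hy
        rw [hli] at hx
        rw [hh'] at hy
        obtain rfl : i = x := by simpa using hx
        obtain rfl : o = y := by simpa using hy
        obtain ⟨B, hB, hoB⟩ := hOL o ho
        exact ((hs.1 B hB).2 i (hIA hiI) o hoB).1 hio
      · refine List.nodup_append'.2 ⟨hl.nodup, hn', fun x hx hx' => ?_⟩
        obtain ⟨B, hB, hxB⟩ := hm' x hx'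
        exact hdisj x (hl.mem x hx) B hB hxB
      · intro x hx
        rcases List.mem_append.1 hx with hx | hx
        · exact ⟨A, by simp, hl.mem x hx⟩
        · obtain ⟨B, hB, hxB⟩ := hm' x hx
          exact ⟨B, by simp [hB], hxB⟩
      · simp [List.head?_append, hlh]
      · simp only [List.map_cons, List.sum_cons, List.length_append]
        omega

theorem exists_path_of_gadgets (hk : IsPseudorandom Adj k) (hk0 : 0 < k) (w : Finset V → ℕ)
    (L : List (Finset V)) (hg : ∀ A ∈ L, w A ≠ 0 → IsGadget R k A (w A))
    (hs : L.Pairwise (IsSplit Adj R Q)) :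
    ∃ l : List V, l.IsChain R ∧ l.Nodup ∧ (L.map w).sum ≤ l.length := by
  classical
  have hsum : ∀ L : List (Finset V),
      (L.map w).sum = ((L.filter fun A => w A ≠ 0).map w).sum := by
    intro L
    induction L with
    | nil => rfl
    | cons A L ih => by_cases hA : w A = 0 <;> simp [hA] <;> simpa using ih
  rw [hsum]
  rcases eq_or_ne (L.filter fun A => w A ≠ 0) [] with h | h
  · exact ⟨[], by simp, by simp, by rw [h]; simp⟩
  · obtain ⟨O, hO, hOp⟩ := exists_entrances hk hk0 w _ h
      (fun A hA => by
        rw [List.mem_filter] at hA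
        exact hg A hA.1 (by simpa using hA.2)) (hs.sublist List.filter_sublist)
    obtain ⟨o, ho⟩ : O.Nonempty := Finset.card_pos.1 (by omega)
    obtain ⟨l, h1, h2, -, -, h3⟩ := hOp o ho
    exact ⟨l, h1, h2, h3⟩

/-- Equally long disjoint paths form a gadget. -/
theorem isGadget_of_paths {A : Finset V} {a w : ℕ} (Ps : List (List V))
    (hP : ∀ P ∈ Ps, IsPathIn R A P ∧ P.length = a + w + a) (hd : Ps.Pairwise List.Disjoint)
    (hcount : ∀ g, a * Ps.length < a * g + k → k ≤ a * g) : IsGadget R k A w := by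
  classical
  have hsubd : ∀ (f : List V → List V), (∀ P, (f P).Sublist P) → ∀ Qs : List (List V),
      Qs.Sublist Ps → (∀ P ∈ Ps, (f P).length = a) →
      (Qs.flatMap f).toFinset.card = a * Qs.length := by
    intro f hf Qs hQs hlen
    rw [List.toFinset_card_of_nodup]
    · rw [List.length_flatMap, List.map_congr_left (g := fun _ => a)
        (fun P hP' => hlen P (hQs.subset hP'))]
      simp [mul_comm]
    · rw [List.nodup_flatMap]
      exact ⟨fun P hP' => (hP P (hQs.subset hP')).1.nodup.sublist (hf P),
        (hd.sublist hQs).imp fun hPQ x hx hy => hPQ ((hf _).subset hx) ((hf _).subset hy)⟩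
  have hdrop : ∀ P : List V, (P.drop (a + w)).Sublist P := fun P => List.drop_sublist _ _
  have htake : ∀ P : List V, (P.take a).Sublist P := fun P => List.take_sublist _ _
  refine ⟨(Ps.flatMap fun P => P.drop (a + w)).toFinset, ?_, ?_⟩
  · intro x hx
    rw [List.mem_toFinset, List.mem_flatMap] at hx
    obtain ⟨P, hPs, hx⟩ := hx
    exact (hP P hPs).1.mem x ((hdrop P).subset hx)
  · intro I' hI' hc
    rw [hsubd _ hdrop Ps (List.Sublist.refl _) (fun P hPs => by simp [(hP P hPs).2])] at hc
    let G := Ps.filter fun P => ∃ i ∈ I', i ∈ P.drop (a + w)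
    have hG : G.Sublist Ps := List.filter_sublist
    have hI'G : I' ⊆ (G.flatMap fun P => P.drop (a + w)).toFinset := by
      intro x hx
      have := hI' hx
      rw [List.mem_toFinset, List.mem_flatMap] at this ⊢
      obtain ⟨P, hPs, hxP⟩ := this
      exact ⟨P, List.mem_filter.2 ⟨hPs, by simpa using ⟨x, hx, hxP⟩⟩, hxP⟩
    have hcI := Finset.card_le_card hI'G
    rw [hsubd _ hdrop G hG (fun P hPs => by simp [(hP P hPs).2])] at hcI
    refine ⟨(G.flatMap fun P => P.take a).toFinset, ?_, ?_, ?_⟩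
    · intro x hx
      rw [List.mem_toFinset, List.mem_flatMap] at hx
      obtain ⟨P, hPs, hx⟩ := hx
      exact (hP P (hG.subset hPs)).1.mem x ((htake P).subset hx)
    · rw [hsubd _ htake G hG (fun P hPs => by simp [(hP P hPs).2])]
      exact hcount _ (by omega)
    · intro o ho
      rw [List.mem_toFinset, List.mem_flatMap] at ho
      obtain ⟨P, hPG, hoP⟩ := ho
      have hPP := hP P (hG.subset hPG)
      obtain ⟨i, hi, hiP⟩ : ∃ i ∈ I', i ∈ P.drop (a + w) := by
        simpa using (List.mem_filter.1 hPG).2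
      obtain ⟨s, t, hst⟩ := List.append_of_mem hoP
      obtain ⟨s', t', hst'⟩ := List.append_of_mem hiP
      have hmid : P = P.take a ++ (P.drop a).take w ++ P.drop (a + w) := by
        rw [List.append_assoc, ← List.drop_drop, List.take_append_drop, List.take_append_drop]
      refine ⟨o :: t ++ (P.drop a).take w ++ s' ++ [i], hPP.1.of_infix ⟨s, t', ?_⟩, by simp,
        ⟨i, hi, List.getLast?_concat⟩, ?_⟩
      · conv_rhs => rw [hmid, hst, hst']
        simp
      · simp [hPP.2]
        omega

theorem isGadget_of_longestPath (R : V → V → Prop) {A : Finset V}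
    (h : longestPath R A - 2 * k ≠ 0) : IsGadget R k A (longestPath R A - 2 * k) := by
  obtain ⟨l, hl, hll⟩ := exists_length_eq_longestPath R A
  refine isGadget_of_paths (a := k) [l] (by simpa using ⟨hl, by omega⟩) (by simp) fun g hg => ?_
  have : 0 < g := by
    rcases Nat.eq_zero_or_pos g with rfl | h
    · simp at hg
    · exact h
  exact Nat.le_mul_of_pos_right k this

theorem exists_path_of_sq_lt {S : Finset V} {p : ℕ} (hR : ∀ v, ¬ R v v) (hQ : ∀ v, ¬ Q v v)
    (hT : ∀ u ∈ S, ∀ v ∈ S, u ≠ v → R u v ∨ Q u v ∨ R v u ∨ Q v u) (hS : p * p < S.card) :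
    ∃ l, (IsPathIn R S l ∨ IsPathIn Q S l) ∧ l.length = p + 1 := by
  classical
  by_contra! hcon
  have short : ∀ T : V → V → Prop,
      (∀ l : List V, IsPathIn T S l → IsPathIn R S l ∨ IsPathIn Q S l) →
      ∀ l : List S, l.IsChain (fun u v : S => T u v) → l.Nodup → l.length ≤ p := by
    intro T hT l hl hn
    by_contra! hlp
    have hpath : IsPathIn T S (l.map Subtype.val) :=
      ⟨(List.isChain_map _).2 hl, hn.map Subtype.val_injective,
        fun x hx => by
          obtain ⟨y, -, rfl⟩ := List.mem_map.1 hx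
          exact y.2⟩
    refine hcon _ (hT _ (hpath.of_infix (List.take_prefix (p + 1) _).isInfix)) ?_
    simp
    omega
  obtain ⟨f, hf⟩ := exists_proper_coloring_of_longestPath_le (V := S) (p := p)
    (R := fun u v => R u v)
    (fun v => hR v) (short R fun _ => Or.inl)
  obtain ⟨g, hg⟩ := exists_proper_coloring_of_longestPath_le (V := S) (p := p)
    (R := fun u v => Q u v)
    (fun v => hQ v) (short Q fun _ => Or.inr)
  have hinj : Function.Injective fun v : S => (f v, g v) := by
    intro u v huv
    by_contra hne
    rw [Prod.mk.injEq] at huv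
    rcases hT u u.2 v v.2 (fun h => hne (Subtype.ext h)) with h | h | h | h
    · exact hf u v h huv.1
    · exact hg u v h huv.2
    · exact hf v u h huv.1.symm
    · exact hg v u h huv.2.symm
  have := Fintype.card_le_of_injective _ hinj
  simp at this
  omega

theorem exists_disjoint_paths {p : ℕ} (hR : ∀ v, ¬ R v v) (hQ : ∀ v, ¬ Q v v) (m : ℕ)
    {S : Finset V} (hT : ∀ u ∈ S, ∀ v ∈ S, u ≠ v → R u v ∨ Q u v ∨ R v u ∨ Q v u)
    (hS : p * p + (p + 1) * m < S.card) :
    ∃ Ps Qs : List (List V), (∀ P ∈ Ps, IsPathIn R S P ∧ P.length = p + 1) ∧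
      (∀ P ∈ Qs, IsPathIn Q S P ∧ P.length = p + 1) ∧ Ps.Pairwise List.Disjoint ∧
      Qs.Pairwise List.Disjoint ∧ Ps.length + Qs.length = m := by
  classical
  induction m generalizing S with
  | zero => exact ⟨[], [], by simp, by simp, by simp, by simp, rfl⟩
  | succ m ih =>
    rw [mul_add, mul_one] at hS
    obtain ⟨l, hl, hlen⟩ := exists_path_of_sq_lt hR hQ hT (p := p) (by omega)
    have hc : S.card ≤ (S \ l.toFinset).card + (p + 1) := by
      have := Finset.le_card_sdiff l.toFinset S
      have := l.toFinset_card_le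
      omega
    have hsub : S \ l.toFinset ⊆ S := Finset.sdiff_subset
    obtain ⟨Ps, Qs, hP, hQs, hPd, hQd, hPQ⟩ := ih (S := S \ l.toFinset)
      (fun u hu v hv => hT u (hsub hu) v (hsub hv)) (by omega)
    have hdisj : ∀ P : List V, (∀ x ∈ P, x ∈ S \ l.toFinset) → l.Disjoint P := by
      intro P hP x hx hxP
      exact (Finset.mem_sdiff.1 (hP x hxP)).2 (List.mem_toFinset.2 hx)
    have hP' : ∀ P ∈ Ps, IsPathIn R S P ∧ P.length = p + 1 :=
      fun P h => ⟨(hP P h).1.mono hsub, (hP P h).2⟩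
    have hQ' : ∀ P ∈ Qs, IsPathIn Q S P ∧ P.length = p + 1 :=
      fun P h => ⟨(hQs P h).1.mono hsub, (hQs P h).2⟩
    rcases hl with hl | hl
    · refine ⟨l :: Ps, Qs, ?_, hQ', List.pairwise_cons.2 ⟨fun P h => hdisj P (hP P h).1.mem, hPd⟩,
        hQd, by simp; omega⟩
      simpa using ⟨⟨hl, hlen⟩, hP'⟩
    · refine ⟨Ps, l :: Qs, hP', ?_, hPd,
        List.pairwise_cons.2 ⟨fun P h => hdisj P (hQs P h).1.mem, hQd⟩, by simp; omega⟩
      simpa using ⟨⟨hl, hlen⟩, hQ'⟩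

theorem isGadget_or_isGadget {u m : ℕ} (hR : ∀ v, ¬ R v v) (hQ : ∀ v, ¬ Q v v) (hu : 0 < u)
    (hm : 2 * k ≤ u * m) {S : Finset V}
    (hT : ∀ u ∈ S, ∀ v ∈ S, u ≠ v → R u v ∨ Q u v ∨ R v u ∨ Q v u)
    (hS : 9 * u * u + 6 * u * m ≤ S.card) : IsGadget R k S u ∨ IsGadget Q k S u := by
  obtain ⟨p, hp⟩ : ∃ p, u + u + u = p + 1 := ⟨u + u + u - 1, by omega⟩
  obtain ⟨Ps, Qs, hP, hQs, hPd, hQd, hPQ⟩ :=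
    exists_disjoint_paths (p := p) hR hQ (2 * m) hT (by nlinarith)
  have count : ∀ t, m ≤ t → ∀ g, u * t < u * g + k → k ≤ u * g := by
    intro t ht g hg
    have := Nat.mul_le_mul_left u ht
    omega
  rcases le_or_gt m Ps.length with h | h
  · exact Or.inl (isGadget_of_paths Ps (fun P hPs => ⟨(hP P hPs).1, by rw [(hP P hPs).2, hp]⟩) hPd
      (count _ h))
  · exact Or.inr (isGadget_of_paths Qs (fun P hPs => ⟨(hQs P hPs).1, by rw [(hQs P hPs).2, hp]⟩)
      hQd (count _ (by omega)))

theorem exists_isSplit_card_le (hk : IsPseudorandom Adj k) {S : Finset V}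
    (hS : ∀ u ∈ S, ∀ v ∈ S, Adj u v → R u v ∨ Q u v) :
    ∃ A B, A ⊆ S ∧ B ⊆ S ∧ 2 * A.card ≤ S.card ∧ 2 * B.card ≤ S.card ∧ IsSplit Adj R Q A B ∧
      S.card ≤ A.card + B.card + 2 * (longestPath R S + longestPath Q S) + 2 * k + 1 := by
  rcases le_or_gt (2 * (longestPath R S + longestPath Q S) + 2 * k) S.card with h | h
  · obtain ⟨A, B, hA, hB, hAc, hBc, hAB⟩ := exists_isSplit hk hS
      (h := S.card / 2 - (longestPath R S + longestPath Q S) - k) (by omega)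
    exact ⟨A, B, hA, hB, by omega, by omega, hAB, by omega⟩
  · exact ⟨∅, ∅, by simp, by simp, by simp, by simp, ⟨by simp, by simp⟩, by omega⟩

theorem exists_refinement (hk : IsPseudorandom Adj k) (L : List (Finset V))
    (hL : ∀ A ∈ L, ∀ u ∈ A, ∀ v ∈ A, Adj u v → R u v ∨ Q u v)
    (hs : L.Pairwise (IsSplit Adj R Q)) :
    ∃ L' : List (Finset V), L'.Pairwise (IsSplit Adj R Q) ∧ L'.length = 2 * L.length ∧
      (∀ X ∈ L', ∃ Y ∈ L, X ⊆ Y ∧ 2 * X.card ≤ Y.card) ∧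
      (L.map Finset.card).sum ≤ (L'.map Finset.card).sum +
        2 * ((L.map (longestPath R)).sum + (L.map (longestPath Q)).sum) +
          (2 * k + 1) * L.length := by
  induction L with
  | nil => exact ⟨[], by simp, rfl, by simp, by simp⟩
  | cons S L ih =>
    rw [List.pairwise_cons] at hs
    obtain ⟨L', hs', hlen, hsub, hsum⟩ := ih (fun A hA => hL A (by simp [hA])) hs.2
    obtain ⟨A, B, hA, hB, hAc, hBc, hAB, hc⟩ := exists_isSplit_card_le hk (hL S (by simp))
    have hcross : ∀ C ⊆ S, ∀ X ∈ L', IsSplit Adj R Q C X := by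
      intro C hC X hX
      obtain ⟨Y, hY, hXY, -⟩ := hsub X hX
      exact (hs.1 Y hY).mono hC hXY
    refine ⟨A :: B :: L', ?_, by simp [hlen, mul_add], ?_, ?_⟩
    · rw [List.pairwise_cons, List.pairwise_cons]
      refine ⟨fun X hX => ?_, hcross B hB, hs'⟩
      rcases List.mem_cons.1 hX with rfl | hX
      · exact hAB
      · exact hcross A hA X hX
    · intro X hX
      rcases List.mem_cons.1 hX with rfl | hX
      · exact ⟨S, by simp, hA, hAc⟩
      rcases List.mem_cons.1 hX with rfl | hX
      · exact ⟨S, by simp, hB, hBc⟩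
      · obtain ⟨Y, hY, h⟩ := hsub X hX
        exact ⟨Y, by simp [hY], h⟩
    · simp only [List.map_cons, List.sum_cons, List.length_cons]
      rw [mul_add _ L.length]
      omega

theorem sum_longestPath_le {n : ℕ} (hk : IsPseudorandom Adj k) (hk0 : 0 < k)
    (hn : ∀ l : List V, l.Nodup → l.IsChain R → l.length < n) (L : List (Finset V))
    (hs : L.Pairwise (IsSplit Adj R Q)) :
    (L.map (longestPath R)).sum ≤ n + 2 * k * L.length := by
  obtain ⟨l, h1, h2, h3⟩ := exists_path_of_gadgets hk hk0 (fun A => longestPath R A - 2 * k) L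
    (fun A _ hA => isGadget_of_longestPath R hA) hs
  have hlt := hn l h2 h1
  have : ∀ L : List (Finset V), (L.map (longestPath R)).sum ≤
      (L.map fun A => longestPath R A - 2 * k).sum + 2 * k * L.length := by
    intro L
    induction L with
    | nil => simp
    | cons A L ih =>
      simp only [List.map_cons, List.sum_cons, List.length_cons]
      rw [mul_add _ L.length]
      omega
  have := this L
  omega

theorem exists_split_list {n : ℕ} (hk : IsPseudorandom Adj k) (hk0 : 0 < k)
    (hnR : ∀ l : List V, l.Nodup → l.IsChain R → l.length < n)
    (hnQ : ∀ l : List V, l.Nodup → l.IsChain Q → l.length < n) {S : Finset V}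
    (hS : ∀ u ∈ S, ∀ v ∈ S, Adj u v → R u v ∨ Q u v) (j : ℕ) :
    ∃ L : List (Finset V), L.Pairwise (IsSplit Adj R Q) ∧ L.length = 2 ^ j ∧
      (∀ A ∈ L, A ⊆ S ∧ 2 ^ j * A.card ≤ S.card) ∧
      S.card ≤ (L.map Finset.card).sum + 4 * n * j + 11 * k * 2 ^ j := by
  induction j with
  | zero => exact ⟨[S], by simp, rfl, by simp, by simp⟩
  | succ j ih =>
    obtain ⟨L, hs, hlen, hL, hsum⟩ := ih
    obtain ⟨L', hs', hlen', hL', hsum'⟩ := exists_refinement hk L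
      (fun A hA u hu v hv => hS u ((hL A hA).1 hu) v ((hL A hA).1 hv)) hs
    have h1 := sum_longestPath_le hk hk0 hnR L hs
    have h2 := sum_longestPath_le hk hk0 hnQ L.reverse
      (List.pairwise_reverse.2 (hs.imp fun h => h.swap))
    rw [List.map_reverse, List.sum_reverse, List.length_reverse] at h2
    refine ⟨L', hs', by rw [hlen', hlen]; ring, ?_, ?_⟩
    · intro X hX
      obtain ⟨Y, hY, hXY, hc⟩ := hL' X hX
      refine ⟨hXY.trans (hL Y hY).1, ?_⟩
      calc 2 ^ (j + 1) * X.card = 2 ^ j * (2 * X.card) := by ring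
        _ ≤ 2 ^ j * Y.card := Nat.mul_le_mul_left _ hc
        _ ≤ _ := (hL Y hY).2
    · rw [hlen] at h1 h2 hsum'
      have hD : 2 ^ j ≤ k * 2 ^ j := Nat.le_mul_of_pos_left _ hk0
      rw [pow_succ]
      nlinarith

/-- In a large two-colored pseudorandom tournament there is a long monochromatic path. -/
theorem exists_long_path {n J u m : ℕ} (hk : IsPseudorandom Adj k) (hk0 : 0 < k)
    (hAdj : ∀ x y, x ≠ y → Adj x y ∨ Adj y x) (hR : ∀ v, ¬ R v v) (hQ : ∀ v, ¬ Q v v)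
    {S : Finset V} (hS : ∀ u ∈ S, ∀ v ∈ S, Adj u v → R u v ∨ Q u v) (hu : 0 < u)
    (hm : 2 * k ≤ u * m) (hn : 8 * n ≤ u * 2 ^ J)
    (hW : 4 * (2 ^ J * (9 * u * u + 6 * u * m)) ≤ S.card)
    (hJ : 2 * (4 * n * J + 11 * k * 2 ^ J) ≤ S.card) (hpos : 0 < S.card) :
    ∃ l : List V, l.Nodup ∧ (l.IsChain R ∨ l.IsChain Q) ∧ n ≤ l.length := by
  classical
  by_contra! hcon
  have hnR : ∀ l : List V, l.Nodup → l.IsChain R → l.length < n :=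
    fun l h1 h2 => hcon l h1 (Or.inl h2)
  have hnQ : ∀ l : List V, l.Nodup → l.IsChain Q → l.length < n :=
    fun l h1 h2 => hcon l h1 (Or.inr h2)
  obtain ⟨L, hs, hlen, hL, hsum⟩ := exists_split_list hk hk0 hnR hnQ hS J
  let w : (V → V → Prop) → Finset V → ℕ := fun T A => if IsGadget T k A u then u else 0
  have hw : ∀ T A, w T A ≠ 0 → IsGadget T k A (w T A) := by
    intro T A h
    by_cases hg : IsGadget T k A u
    · simp [w, hg]
    · simp [w, hg] at h
  obtain ⟨l, h1, h2, h3⟩ := exists_path_of_gadgets hk hk0 (w R) L (fun A _ => hw R A) hs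
  obtain ⟨l', h1', h2', h3'⟩ := exists_path_of_gadgets hk hk0 (w Q) L.reverse
    (fun A _ => hw Q A) (List.pairwise_reverse.2 (hs.imp fun h => h.swap))
  rw [List.map_reverse, List.sum_reverse] at h3'
  have hl := hnR l h2 h1
  have hl' := hnQ l' h2' h1'
  set W := 9 * u * u + 6 * u * m with hWdef
  set D := 2 ^ J with hD
  have hleaf : ∀ A ∈ L, u * (D * A.card) ≤ u * (D * W) + S.card * (w R A + w Q A) := by
    intro A hA
    rcases le_or_gt W A.card with hWA | hWA
    · have hge : u ≤ w R A + w Q A := by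
        rcases isGadget_or_isGadget (S := A) hR hQ hu hm (fun x hx y hy hxy => by
          have hx := (hL A hA).1 hx
          have hy := (hL A hA).1 hy
          rcases hAdj x y hxy with h | h
          · have := hS x hx y hy h
            tauto
          · have := hS y hy x hx h
            tauto) hWA with hg | hg <;> simp [w, hg]
      calc u * (D * A.card) ≤ u * S.card := Nat.mul_le_mul_left _ (hL A hA).2
        _ = S.card * u := mul_comm _ _
        _ ≤ S.card * (w R A + w Q A) := Nat.mul_le_mul_left _ hge
        _ ≤ _ := Nat.le_add_left _ _
    · have : u * (D * A.card) ≤ u * (D * W) := by gcongr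
      omega
  have htotal : ∀ L : List (Finset V),
      (∀ A ∈ L, u * (D * A.card) ≤ u * (D * W) + S.card * (w R A + w Q A)) →
      u * (D * (L.map Finset.card).sum) ≤ u * (D * W) * L.length +
        S.card * ((L.map (w R)).sum + (L.map (w Q)).sum) := by
    intro L hL
    induction L with
    | nil => simp
    | cons A L ih =>
      have h1 := hL A (by simp)
      have h2 := ih fun B hB => hL B (by simp [hB])
      simp only [List.map_cons, List.sum_cons, List.length_cons]
      nlinarith
  have hmain := htotal L hleaf
  rw [hlen] at hmain
  have hlt : (L.map (w R)).sum + (L.map (w Q)).sum < 2 * n := by omega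
  have e1 : S.card * ((L.map (w R)).sum + (L.map (w Q)).sum) < S.card * (2 * n) :=
    Nat.mul_lt_mul_of_pos_left hlt hpos
  have e2 : S.card * (8 * n) ≤ S.card * (u * D) := Nat.mul_le_mul_left _ hn
  have e3 : u * D * (4 * (D * W)) ≤ u * D * S.card := Nat.mul_le_mul_left _ hW
  have e4 : S.card ≤ 2 * (L.map Finset.card).sum := by omega
  have e5 : u * D * S.card ≤ u * D * (2 * (L.map Finset.card).sum) := Nat.mul_le_mul_left _ e4
  nlinarith

end Colored

section Random

/-- The tournament on `Fin N` whose edges are oriented by `σ`. -/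
def tournamentOf {N : ℕ} (σ : Fin N × Fin N → Bool) (i j : Fin N) : Prop :=
  (i < j ∧ σ (i, j) = true) ∨ (j < i ∧ σ (j, i) = false)

/-- Few orientations have no edge from `A` to `B`. -/
theorem card_filter_no_edge_mul_le {N : ℕ} {A B : Finset (Fin N)} (hAB : Disjoint A B)
    (F : Finset (Fin N × Fin N → Bool))
    (hF : ∀ σ ∈ F, ∀ a ∈ A, ∀ b ∈ B, ¬ tournamentOf σ a b) :
    F.card * 2 ^ (A.card * B.card) ≤ 2 ^ (N * N) := by
  classical
  have hne : ∀ x ∈ A, ∀ y ∈ B, x ≠ y := fun x hx y hy hxy =>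
    Finset.disjoint_left.1 hAB hx (hxy ▸ hy)
  let e : Fin N × Fin N → Fin N × Fin N := fun x => (min x.1 x.2, max x.1 x.2)
  let S := (A ×ˢ B).image e
  have hS : S.card = A.card * B.card := by
    rw [← Finset.card_product]
    refine Finset.card_image_of_injOn ?_
    rintro ⟨a, b⟩ hab ⟨a', b'⟩ hab' h
    simp only [Finset.coe_product, Set.mem_prod, Finset.mem_coe] at hab hab'
    have h1 := hne a hab.1 b' hab'.2
    have h2 := hne a' hab'.1 b hab.2
    have h3 := hne a hab.1 b hab.2
    have h4 := hne a' hab'.1 b' hab'.2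
    simp only [e, Prod.mk.injEq] at h ⊢
    rcases lt_or_gt_of_ne h3 with h3 | h3 <;> rcases lt_or_gt_of_ne h4 with h4 | h4 <;>
      simp [min_eq_left h3.le, max_eq_right h3.le, min_eq_right h3.le, max_eq_left h3.le,
        min_eq_left h4.le, max_eq_right h4.le, min_eq_right h4.le, max_eq_left h4.le] at h <;>
      tauto
  let T : Fin N × Fin N → Finset Bool := fun x =>
    if x ∈ S then {decide (x.1 ∉ A)} else Finset.univ
  have hFT : F ⊆ Fintype.piFinset T := by
    intro σ hσ
    rw [Fintype.mem_piFinset]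
    intro x
    by_cases hx : x ∈ S
    · simp only [T, hx, if_true, Finset.mem_singleton]
      obtain ⟨⟨a, b⟩, hab, rfl⟩ := Finset.mem_image.1 hx
      rw [Finset.mem_product] at hab
      have hnot := hF σ hσ a hab.1 b hab.2
      have hbA : b ∉ A := fun h => hne b h b hab.2 rfl
      rcases lt_or_gt_of_ne (hne a hab.1 b hab.2) with h | h
      · have : e (a, b) = (a, b) := by simp [e, h.le]
        rw [this]
        simpa [tournamentOf, h, h.le, hab.1] using hnot
      · have : e (a, b) = (b, a) := by simp [e, h.le]
        rw [this]
        simpa [tournamentOf, h, h.le, hbA] using hnot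
    · simp [T, hx]
  calc F.card * 2 ^ (A.card * B.card) ≤ (Fintype.piFinset T).card * 2 ^ S.card := by
        rw [hS]
        exact Nat.mul_le_mul_right _ (Finset.card_le_card hFT)
    _ = (∏ x, (T x).card) * ∏ x, (if x ∈ S then 2 else 1) := by
        rw [Fintype.card_piFinset, Finset.prod_ite_mem, Finset.univ_inter, Finset.prod_const]
    _ = ∏ _x : Fin N × Fin N, 2 := by
        rw [← Finset.prod_mul_distrib]
        refine Finset.prod_congr rfl fun x _ => ?_
        by_cases hx : x ∈ S <;> simp [T, hx]
    _ = 2 ^ (N * N) := by simp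

theorem exists_isPseudorandom_tournament {N k : ℕ} (hN : N * N < 2 ^ k) (hk : 0 < k) :
    ∃ Adj : Fin N → Fin N → Prop, (∀ v, ¬ Adj v v) ∧ (∀ u v, ¬ (Adj u v ∧ Adj v u)) ∧
      (∀ u v, u ≠ v → Adj u v ∨ Adj v u) ∧ IsPseudorandom Adj k := by
  classical
  suffices h : ∃ σ : Fin N × Fin N → Bool, ∀ A B : Finset (Fin N), Disjoint A B → A.card = k →
      B.card = k → ∃ a ∈ A, ∃ b ∈ B, tournamentOf σ a b by
    obtain ⟨σ, hσ⟩ := h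
    refine ⟨tournamentOf σ, fun v => by simp [tournamentOf], fun u v h => ?_, fun u v h => ?_,
      fun A B hAB hA hB => ?_⟩
    · rcases h with ⟨⟨h1, h1'⟩ | ⟨h1, h1'⟩, ⟨h2, h2'⟩ | ⟨h2, h2'⟩⟩
      · exact lt_asymm h1 h2
      · simp [h1'] at h2'
      · simp [h1'] at h2'
      · exact lt_asymm h1 h2
    · rcases lt_or_gt_of_ne h with h | h
      · cases hs : σ (u, v) <;> simp [tournamentOf, h, h.not_gt, hs]
      · cases hs : σ (v, u) <;> simp [tournamentOf, h, h.not_gt, hs]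
    · obtain ⟨A', hA', hAc⟩ := Finset.exists_subset_card_eq hA
      obtain ⟨B', hB', hBc⟩ := Finset.exists_subset_card_eq hB
      obtain ⟨a, ha, b, hb, hab⟩ := hσ A' B' (hAB.mono hA' hB') hAc hBc
      exact ⟨a, hA' ha, b, hB' hb, hab⟩
  by_contra! hcon
  let I := ((Finset.univ.powersetCard k) ×ˢ (Finset.univ.powersetCard k) :
    Finset (Finset (Fin N) × Finset (Fin N))).filter fun X => Disjoint X.1 X.2
  let bad : Finset (Fin N) × Finset (Fin N) → Finset (Fin N × Fin N → Bool) := fun X =>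
    Finset.univ.filter fun σ => ∀ a ∈ X.1, ∀ b ∈ X.2, ¬ tournamentOf σ a b
  have hcover : (Finset.univ : Finset (Fin N × Fin N → Bool)) ⊆ I.biUnion bad := by
    intro σ _
    obtain ⟨A, B, hAB, hA, hB, h⟩ := hcon σ
    simp only [Finset.mem_biUnion]
    exact ⟨(A, B), by simp [I, hA, hB, hAB], by simpa [bad] using h⟩
  have hbad : ∀ X ∈ I, (bad X).card * 2 ^ (k * k) ≤ 2 ^ (N * N) := by
    rintro ⟨A, B⟩ hX
    simp only [I, Finset.mem_filter, Finset.mem_product, Finset.mem_powersetCard,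
      Finset.subset_univ, true_and] at hX
    have := card_filter_no_edge_mul_le hX.2 (bad (A, B)) fun σ hσ => by simpa [bad] using hσ
    rwa [hX.1.1, hX.1.2] at this
  have hI : I.card ≤ (N * N) ^ k := by
    refine (Finset.card_filter_le _ _).trans ?_
    rw [Finset.card_product, Finset.card_powersetCard, Finset.card_univ, Fintype.card_fin, mul_pow]
    exact Nat.mul_le_mul (Nat.choose_le_pow _ _) (Nat.choose_le_pow _ _)
  have h1 : 2 ^ (N * N) ≤ ∑ X ∈ I, (bad X).card := by
    have := (Finset.card_le_card hcover).trans Finset.card_biUnion_le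
    simpa using this
  have h2 : 2 ^ (N * N) * 2 ^ (k * k) ≤ I.card * 2 ^ (N * N) := by
    calc 2 ^ (N * N) * 2 ^ (k * k) ≤ (∑ X ∈ I, (bad X).card) * 2 ^ (k * k) :=
          Nat.mul_le_mul_right _ h1
      _ = ∑ X ∈ I, (bad X).card * 2 ^ (k * k) := Finset.sum_mul _ _ _
      _ ≤ ∑ _X ∈ I, 2 ^ (N * N) := Finset.sum_le_sum hbad
      _ = _ := by simp
  have h3 : (N * N) ^ k < 2 ^ (k * k) := by
    rw [pow_mul]
    exact Nat.pow_lt_pow_left hN hk.ne'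
  have h4 : 2 ^ (N * N) * 2 ^ (k * k) ≤ 2 ^ (N * N) * I.card := by rwa [mul_comm _ I.card]
  have := Nat.le_of_mul_le_mul_left h4 (by positivity)
  omega

end Random

/-- Every `(q + 2)`-coloring of a large pseudorandom tournament has a long monochromatic path. -/
theorem exists_mono_path {V : Type} [Fintype V] {Adj : V → V → Prop} {q n M k J u m : ℕ}
    (hirr : ∀ v, ¬ Adj v v) (htot : ∀ x y, x ≠ y → Adj x y ∨ Adj y x)
    (hk : IsPseudorandom Adj k) (hk0 : 0 < k) (hV : n ^ q * M ≤ Fintype.card V) (hu : 0 < u)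
    (hm : 2 * k ≤ u * m) (hn0 : 0 < n) (hn : 8 * n ≤ u * 2 ^ J)
    (hW : 4 * (2 ^ J * (9 * u * u + 6 * u * m)) ≤ M)
    (hJ : 2 * (4 * n * J + 11 * k * 2 ^ J) ≤ M) (hM : 0 < M) (c : V → V → Fin (q + 2)) :
    ∃ i, ∃ l : List V, l.Nodup ∧ l.IsChain (fun x y => Adj x y ∧ c x y = i) ∧ n ≤ l.length := by
  classical
  by_contra! hcon
  choose f hf using fun i => exists_proper_coloring_of_longestPath_le
    (R := fun x y => Adj x y ∧ c x y = i) (p := n) (fun v h => hirr v h.1)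
    (fun l h1 h2 => (hcon i l h2 h1).le)
  have : Nonempty (Fin n) := ⟨⟨0, hn0⟩⟩
  obtain ⟨y, hy⟩ := Fintype.exists_le_card_fiber_of_mul_le_card (n := M)
    (fun (v : V) (j : Fin q) => f j.castSucc.castSucc v) (by simpa using hV)
  let S : Finset V := Finset.univ.filter fun v => (fun j : Fin q => f j.castSucc.castSucc v) = y
  have hS : M ≤ S.card := hy
  obtain ⟨l, hl, hl', hln⟩ := exists_long_path (S := S) (J := J)
    (R := fun x y => Adj x y ∧ c x y = (Fin.last q).castSucc)
    (Q := fun x y => Adj x y ∧ c x y = Fin.last (q + 1)) hk hk0 htot (fun v h => hirr v h.1)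
    (fun v h => hirr v h.1) (fun x hx z hz hxz => by
      have hx := congrFun (Finset.mem_filter.1 hx).2
      have hz := congrFun (Finset.mem_filter.1 hz).2
      rcases Fin.eq_castSucc_or_eq_last (c x z) with ⟨i, hi⟩ | hi
      · rcases Fin.eq_castSucc_or_eq_last i with ⟨j, rfl⟩ | rfl
        · exact absurd ((hx j).trans (hz j).symm) (hf _ x z ⟨hxz, hi⟩)
        · exact Or.inl ⟨hxz, hi⟩
      · exact Or.inr ⟨hxz, hi⟩) hu hm hn (hW.trans hS) (hJ.trans hS) (hM.trans_le hS)
  rcases hl' with h | h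
  · exact (hcon _ l hl h).not_ge hln
  · exact (hcon _ l hl h).not_ge hln

theorem exists_isDiPath_isMono {V : Type} {Adj : V → V → Prop} {q n : ℕ} {c : V → V → Fin q}
    {i : Fin q} {l : List V} (hn : 0 < n) (hl : l.Nodup)
    (hc : l.IsChain (fun x y => Adj x y ∧ c x y = i)) (hln : n ≤ l.length) :
    ∃ p : Fin (n - 1 + 1) → V, IsDiPath Adj p ∧ IsMono c p := by
  have hstep := List.isChain_iff_getElem.1 hc
  refine ⟨fun j => l[(j : ℕ)]'(by omega), ⟨fun a b hab => ?_, fun j => ?_⟩, i, fun j => ?_⟩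
  · exact Fin.ext ((hl.getElem_inj_iff).1 hab)
  · exact (hstep j (by omega)).1
  · exact (hstep j (by omega)).2

theorem vertexCount_sq_lt {q n L : ℕ} (hn : n < 2 ^ (L + 1)) (hL : q + 10 ≤ L) :
    1000 * n ^ q * L * (1000 * n ^ q * L) < 2 ^ (2 * (q + 2) * L) := by
  have h : 1000 * n ^ q * L < 2 ^ ((q + 2) * L) := by
    calc 1000 * n ^ q * L ≤ 2 ^ 10 * (2 ^ (L + 1)) ^ q * L := by gcongr; norm_num
      _ < 2 ^ 10 * (2 ^ (L + 1)) ^ q * 2 ^ L := by gcongr; exact Nat.lt_two_pow_self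
      _ = 2 ^ (10 + (L + 1) * q + L) := by rw [← pow_mul, ← pow_add, ← pow_add]
      _ ≤ 2 ^ ((q + 2) * L) := Nat.pow_le_pow_right (by norm_num) (by nlinarith)
  calc _ < 2 ^ ((q + 2) * L) * 2 ^ ((q + 2) * L) := Nat.mul_lt_mul'' h h
    _ = _ := by rw [← pow_add]; ring_nf

/-- There is `c₂ > 0` such that for every `q ≥ 1` there is `n₀` such that for every
`n ≥ n₀` there is an oriented graph with at most `c₂ · n^{2q} · (log n)²` edges in which
every `(q+1)`-coloring of the edges contains a monochromatic directed path on `n`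
vertices (i.e. with `n - 1` edges). Logarithms are base 2. -/
theorem stmt_1 :
    ∃ c₂ : ℝ, 0 < c₂ ∧
      ∀ q : ℕ, 1 ≤ q →
        ∃ n₀ : ℕ, ∀ n : ℕ, n₀ ≤ n →
          ∃ (V : Type) (_ : Fintype V) (Adj : V → V → Prop),
            IsOriented Adj ∧
            (({e : V × V | Adj e.1 e.2}.ncard : ℝ) ≤
              c₂ * (n : ℝ) ^ (2 * q) * (Real.logb 2 n) ^ 2) ∧
            ∀ c : V → V → Fin (q + 1),
              ∃ p : Fin (n - 1 + 1) → V, IsDiPath Adj p ∧ IsMono c p := by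
  refine ⟨1000 ^ 2, by norm_num, fun q hq => ⟨2 ^ 2 ^ (12 * q), fun n hn => ?_⟩⟩
  have hn0 : 0 < n := lt_of_lt_of_le (by positivity) hn
  obtain ⟨L, hL⟩ : ∃ L, L = Nat.log 2 n := ⟨_, rfl⟩
  have hLn : 2 ^ L ≤ n := hL ▸ Nat.pow_log_le_self 2 hn0.ne'
  have hnL : n < 2 ^ (L + 1) := hL ▸ Nat.lt_pow_succ_log_self (by norm_num) n
  have hu : 2 ^ (12 * q) ≤ L := hL ▸ Nat.le_log_of_pow_le (by norm_num) hn
  have hqu : 12 * q < 2 ^ (12 * q) := Nat.lt_two_pow_self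
  have hL0 : 0 < L := by omega
  obtain ⟨Adj, hirr, hanti, htot, hps⟩ := exists_isPseudorandom_tournament
    (vertexCount_sq_lt (q := q) hnL (by omega)) (by positivity)
  refine ⟨Fin (1000 * n ^ q * L), inferInstance, Adj, ⟨hirr, hanti⟩, ?_, fun c => ?_⟩
  · have h1 : {e : Fin (1000 * n ^ q * L) × Fin (1000 * n ^ q * L) | Adj e.1 e.2}.ncard ≤
        1000 * n ^ q * L * (1000 * n ^ q * L) := by
      refine (Set.ncard_le_card _).trans ?_
      simp
    have h2 : (L : ℝ) ≤ Real.logb 2 n := by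
      rw [hL]
      exact_mod_cast Real.natLog_le_logb n 2
    calc _ ≤ ((1000 * n ^ q * L * (1000 * n ^ q * L) : ℕ) : ℝ) := by exact_mod_cast h1
      _ = 1000 ^ 2 * (n : ℝ) ^ (2 * q) * (L : ℝ) ^ 2 := by push_cast; ring
      _ ≤ _ := by gcongr
  · obtain ⟨q, rfl⟩ : ∃ r, q = r + 1 := ⟨q - 1, by omega⟩
    set u := 2 ^ (12 * (q + 1)) with hudef
    obtain ⟨J, hJ⟩ : ∃ J, 12 * (q + 1) + J = L + 4 := ⟨L + 4 - 12 * (q + 1), by omega⟩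
    have huJ : u * 2 ^ J = 16 * 2 ^ L := by rw [hudef, ← pow_add, hJ, pow_add]; ring
    have hkL : 2 * (q + 1 + 2) * L ≤ u * L := Nat.mul_le_mul_right _ (by omega)
    have hkJ : 2 * (q + 1 + 2) * L * 2 ^ J ≤ 16 * (n * L) := by
      calc _ ≤ u * L * 2 ^ J := Nat.mul_le_mul_right _ hkL
        _ = 16 * (2 ^ L * L) := by rw [mul_right_comm, huJ]; ring
        _ ≤ _ := by gcongr
    obtain ⟨i, l, hl, hc, hln⟩ := exists_mono_path (n := n) (M := 1000 * n * L) (J := J) (u := u)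
      (m := L) hirr htot hps (by positivity) (by rw [Fintype.card_fin]; apply le_of_eq; ring)
      (by positivity) (by
        rw [← mul_assoc, ← mul_assoc]
        exact Nat.mul_le_mul_right _ (by omega)) hn0 (by rw [huJ]; rw [pow_succ] at hnL; omega) (by
        calc 4 * (2 ^ J * (9 * u * u + 6 * u * L))
            = 4 * (u * 2 ^ J) * (9 * u + 6 * L) := by ring
          _ ≤ 4 * (16 * n) * (9 * L + 6 * L) := by rw [huJ]; gcongr
          _ ≤ 1000 * n * L := by nlinarith) (by
        have hJL : n * J ≤ n * L := Nat.mul_le_mul_left _ (by omega)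
        nlinarith) (by positivity) c
    exact exists_isDiPath_isMono hn0 hl hc hln
end

section
/- For every integer q ≥ 1 there exist a real constant C > 0 and a natural number n₀ such that for every n ≥ n₀ there exists a tournament T on ⌈C · n^q · log n⌉ vertices such that every (q+1)-coloring of the edges of T contains a monochromatic directed path on n vertices. -/
/-- A tournament: irreflexive, and for `u ≠ v` exactly one of `Adj u v`, `Adj v u` holds. -/
def IsTournament {V : Type} (Adj : V → V → Prop) : Prop :=
  Irreflexive Adj ∧ ∀ u v : V, u ≠ v → (Adj u v ↔ ¬ Adj v u)

/-- `l` lists the vertices of a directed path of `H` inside `S`. -/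
def IsPathIn_s2 {α : Type*} (H : α → α → Prop) (S : Finset α) (l : List α) : Prop :=
  l.Nodup ∧ (∀ x ∈ l, x ∈ S) ∧ l.IsChain H

theorem IsPathIn_s2.length_le_card {α : Type*} {H : α → α → Prop} {S : Finset α} {l : List α}
    (h : IsPathIn_s2 H S l) : l.length ≤ S.card := by
  classical
  rw [← List.toFinset_card_of_nodup h.1]
  exact Finset.card_le_card fun x hx => h.2.1 x (List.mem_toFinset.1 hx)

theorem IsPathIn_s2.mono {α : Type*} {H : α → α → Prop} {S S' : Finset α} {l : List α}
    (h : IsPathIn_s2 H S l) (hS : S ⊆ S') : IsPathIn_s2 H S' l :=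
  ⟨h.1, fun x hx => hS (h.2.1 x hx), h.2.2⟩

open Classical in
/-- The largest number of vertices of a directed path of `H` inside `S`. -/
noncomputable def maxPathLength {α : Type*} (H : α → α → Prop) (S : Finset α) : ℕ :=
  Nat.findGreatest (fun m => ∃ l, IsPathIn_s2 H S l ∧ l.length = m) S.card

theorem exists_isPathIn_length_eq_maxPathLength {α : Type*} (H : α → α → Prop) (S : Finset α) :
    ∃ l, IsPathIn_s2 H S l ∧ l.length = maxPathLength H S := by
  classical
  unfold maxPathLength
  apply Nat.findGreatest_spec (P := fun m => ∃ l, IsPathIn_s2 H S l ∧ l.length = m)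
    (m := 0) (Nat.zero_le _)
  exact ⟨[], ⟨by simp, by simp, by simp⟩, rfl⟩

theorem IsPathIn_s2.length_le {α : Type*} {H : α → α → Prop} {S : Finset α} {l : List α}
    (h : IsPathIn_s2 H S l) : l.length ≤ maxPathLength H S := by
  classical
  exact Nat.le_findGreatest h.length_le_card ⟨l, h, rfl⟩

theorem maxPathLength_mono {α : Type*} (H : α → α → Prop) {S S' : Finset α} (hS : S ⊆ S') :
    maxPathLength H S ≤ maxPathLength H S' := by
  obtain ⟨l, hl, h⟩ := exists_isPathIn_length_eq_maxPathLength H S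
  exact h ▸ (hl.mono hS).length_le

/-- Intermediate states of depth-first search: `U` is unvisited, `F` is finished, and the reverse
of `l` is the current path. -/
theorem exists_dfs_state {α : Type*} [DecidableEq α] (H : α → α → Prop) (S : Finset α) (t : ℕ)
    (ht : t ≤ S.card) :
    ∃ (F U : Finset α) (l : List α), F ⊆ S ∧ U ⊆ S ∧ Disjoint F U ∧
      IsPathIn_s2 (fun a b => H b a) S l ∧ (∀ x ∈ l, x ∉ F ∧ x ∉ U) ∧
      F.card + U.card + l.length = S.card ∧ (∀ a ∈ F, ∀ b ∈ U, ¬ H a b) ∧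
      F.card + S.card = U.card + t := by
  induction t with
  | zero =>
    exact ⟨∅, S, [], by simp, by simp, by simp, ⟨by simp, by simp, by simp⟩, by simp, by simp,
      by simp, by simp⟩
  | succ t ih =>
    obtain ⟨F, U, l, hF, hU, hFU, ⟨hn, hm, hc⟩, hl, hcard, hH, hbal⟩ := ih (by omega)
    have push : ∀ u ∈ U, (∀ y ∈ l.head?, H y u) → ∃ (F U : Finset α) (l : List α), F ⊆ S ∧ U ⊆ S ∧
        Disjoint F U ∧ IsPathIn_s2 (fun a b => H b a) S l ∧ (∀ x ∈ l, x ∉ F ∧ x ∉ U) ∧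
        F.card + U.card + l.length = S.card ∧ (∀ a ∈ F, ∀ b ∈ U, ¬ H a b) ∧
        F.card + S.card = U.card + (t + 1) := by
      intro u hu hy
      have hpos := Finset.card_pos.2 ⟨u, hu⟩
      refine ⟨F, U.erase u, u :: l, hF, (Finset.erase_subset _ _).trans hU,
        hFU.mono_right (Finset.erase_subset _ _), ⟨?_, ?_, ?_⟩, ?_, ?_, ?_, ?_⟩
      · exact List.nodup_cons.2 ⟨fun h => (hl u h).2 hu, hn⟩
      · simpa using ⟨hU hu, hm⟩
      · exact List.isChain_cons.2 ⟨hy, hc⟩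
      · intro x hx
        rcases List.mem_cons.1 hx with rfl | hx
        · exact ⟨fun h => Finset.disjoint_left.1 hFU h hu, by simp⟩
        · exact ⟨(hl x hx).1, fun h => (hl x hx).2 (Finset.mem_of_mem_erase h)⟩
      · rw [Finset.card_erase_of_mem hu, List.length_cons]; omega
      · exact fun a ha b hb => hH a ha b (Finset.mem_of_mem_erase hb)
      · rw [Finset.card_erase_of_mem hu]; omega
    match l, hn, hm, hc, hl, hcard, push with
    | [], _, _, _, _, hcard, push =>
      have : U.Nonempty := by
        rw [← Finset.card_pos]
        simp only [List.length_nil] at hcard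
        omega
      obtain ⟨u, hu⟩ := this
      exact push u hu (by simp)
    | p :: l, hn, hm, hc, hl, hcard, push =>
      by_cases h : ∃ u ∈ U, H p u
      · obtain ⟨u, hu, hpu⟩ := h
        exact push u hu (by simpa using hpu)
      · push Not at h
        have hp := hl p (by simp)
        rw [List.nodup_cons] at hn
        rw [List.length_cons] at hcard
        refine ⟨insert p F, U, l, Finset.insert_subset (hm p (by simp)) hF, hU, ?_,
          ⟨hn.2, fun x hx => hm x (by simp [hx]), (List.isChain_cons.1 hc).2⟩, ?_, ?_, ?_, ?_⟩
        · exact Finset.disjoint_insert_left.2 ⟨hp.2, hFU⟩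
        · intro x hx
          have := hl x (by simp [hx])
          refine ⟨?_, this.2⟩
          rw [Finset.mem_insert]
          rintro (rfl | h')
          · exact hn.1 hx
          · exact this.1 h'
        · rw [Finset.card_insert_of_notMem hp.1]; omega
        · intro a ha b hb
          rcases Finset.mem_insert.1 ha with rfl | ha
          · exact h b hb
          · exact hH a ha b hb
        · rw [Finset.card_insert_of_notMem hp.1]; omega

/-- Apart from the vertices of one directed path, a vertex set splits into two equal parts with no
edge from the first to the second. -/
theorem exists_balanced_nonadjacent {α : Type*} [DecidableEq α] (H : α → α → Prop) (S : Finset α) :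
    ∃ F U : Finset α, F ⊆ S ∧ U ⊆ S ∧ Disjoint F U ∧ F.card = U.card ∧
      (∀ a ∈ F, ∀ b ∈ U, ¬ H a b) ∧ S.card ≤ 2 * F.card + maxPathLength H S := by
  obtain ⟨F, U, l, hF, hU, hFU, ⟨hn, hm, hc⟩, -, hcard, hH, hbal⟩ :=
    exists_dfs_state H S S.card le_rfl
  have hr : IsPathIn_s2 H S l.reverse :=
    ⟨List.nodup_reverse.2 hn, by simpa using hm, List.isChain_reverse.2 hc⟩
  have := hr.length_le
  rw [List.length_reverse] at this
  exact ⟨F, U, hF, hU, hFU, by omega, hH, by omega⟩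

/-- Rooted-forest labellings: every vertex of positive level has a parent on the level below. -/
def IsLevelling {α : Type*} (E : α → α → Prop) (S : Finset α) (f : α → ℕ) (par : α → α) : Prop :=
  ∀ v ∈ S, f v ≠ 0 → par v ∈ S ∧ E (par v) v ∧ f v = f (par v) + 1

theorem IsLevelling.lt_maxPathLength {α : Type*} {E : α → α → Prop} {S : Finset α} {f : α → ℕ}
    {par : α → α} (h : IsLevelling E S f par) {v : α} (hv : v ∈ S) : f v < maxPathLength E S := by
  have key : ∀ j, ∀ v ∈ S, f v = j → ∃ l, IsPathIn_s2 (fun a b => E b a) S (v :: l) ∧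
      l.length = j ∧ ∀ x ∈ l, f x < j := by
    intro j
    induction j with
    | zero => exact fun v hv _ => ⟨[], ⟨by simp, by simpa using hv, by simp⟩, rfl, by simp⟩
    | succ j ih =>
      intro v hv hj
      obtain ⟨hp, hE, hf⟩ := h v hv (by omega)
      obtain ⟨l, ⟨hn, hm, hc⟩, hlen, hlt⟩ := ih (par v) hp (by omega)
      have hlt' : ∀ x ∈ par v :: l, f x < j + 1 := by
        intro x hx
        rcases List.mem_cons.1 hx with rfl | hx
        · omega
        · have := hlt x hx
          omega
      refine ⟨par v :: l, ⟨?_, ?_, ?_⟩, by simp [hlen], hlt'⟩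
      · refine List.nodup_cons.2 ⟨fun hx => ?_, hn⟩
        have := hlt' v hx
        omega
      · intro x hx
        rcases List.mem_cons.1 hx with rfl | hx
        · exact hv
        · exact hm x hx
      · exact List.isChain_cons_cons.2 ⟨hE, hc⟩
  obtain ⟨l, ⟨hn, hm, hc⟩, hlen, -⟩ := key _ v hv rfl
  have hr : IsPathIn_s2 E S (v :: l).reverse :=
    ⟨List.nodup_reverse.2 hn, fun x hx => hm x (List.mem_reverse.1 hx), List.isChain_reverse.2 hc⟩
  have := hr.length_le
  rw [List.length_reverse, List.length_cons] at this
  omega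

/-- If an edge joins two vertices of the same level, its head and the descendants of its head can
be raised by one level. -/
theorem IsLevelling.exists_raise {α : Type*} [DecidableEq α] {E : α → α → Prop} {S : Finset α}
    {f : α → ℕ} {par : α → α} (h : IsLevelling E S f par) {u v : α} (hu : u ∈ S) (hv : v ∈ S)
    (huv : u ≠ v) (hE : E u v) (hf : f u = f v) :
    ∃ f' par', IsLevelling E S f' par' ∧ ∑ x ∈ S, f x < ∑ x ∈ S, f' x := by
  classical
  set D : α → Prop := Relation.ReflTransGen (fun a b => par b = a ∧ f b = f a + 1) v with hD
  have hDlt : ∀ w, D w → w = v ∨ f v < f w := by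
    intro w hw
    induction hw with
    | refl => exact Or.inl rfl
    | tail _ h2 ih =>
      right
      rcases ih with rfl | ih
      · omega
      · omega
  have huD : ¬ D u := fun hh => by
    rcases hDlt u hh with hh | hh
    · exact huv hh
    · omega
  have hvD : D v := Relation.ReflTransGen.refl
  refine ⟨fun w => if D w then f w + 1 else f w, Function.update par v u, ?_, ?_⟩
  · intro w hw hw0
    by_cases hwv : w = v
    · subst hwv
      simp [huD, hvD, hu, hE, hf]
    · rw [Function.update_of_ne hwv]
      by_cases hwD : D w
      · obtain heq | ⟨a, ha, hpa, hfa⟩ := Relation.ReflTransGen.cases_tail hwD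
        · exact absurd heq hwv
        · obtain ⟨h1, h2, h3⟩ := h w hw (by omega)
          have ha' : D (par w) := hpa ▸ ha
          simp only [if_pos hwD, if_pos ha']
          exact ⟨h1, h2, by omega⟩
      · simp only [if_neg hwD] at hw0
        obtain ⟨h1, h2, h3⟩ := h w hw hw0
        have ha' : ¬ D (par w) := fun hh => hwD (hh.tail ⟨rfl, h3⟩)
        simp only [if_neg hwD, if_neg ha']
        exact ⟨h1, h2, h3⟩
  · apply Finset.sum_lt_sum
    · intro x _
      split_ifs <;> omega
    · exact ⟨v, hv, by simp [hvD]⟩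

/-- The Gallai–Roy theorem: a digraph whose directed paths have at most `b` vertices has a proper
colouring with `b` colours. -/
theorem exists_coloring_lt_maxPathLength {α : Type*} (E : α → α → Prop) (S : Finset α) :
    ∃ f : α → ℕ, (∀ v ∈ S, f v < maxPathLength E S) ∧
      ∀ u ∈ S, ∀ v ∈ S, u ≠ v → E u v → f u ≠ f v := by
  classical
  by_contra hcon
  push Not at hcon
  have key : ∀ t : ℕ, ∃ f par, IsLevelling E S f par ∧ t ≤ ∑ x ∈ S, f x := by
    intro t
    induction t with
    | zero => exact ⟨fun _ => 0, id, fun v _ h0 => absurd rfl h0, Nat.zero_le _⟩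
    | succ t ih =>
      obtain ⟨f, par, hl, ht⟩ := ih
      obtain ⟨u, hu, v, hv, huv, hE, hf⟩ := hcon f fun v hv => hl.lt_maxPathLength hv
      obtain ⟨f', par', hl', hlt⟩ := hl.exists_raise hu hv huv hE hf
      exact ⟨f', par', hl', by omega⟩
  obtain ⟨f, par, hl, ht⟩ := key (S.card * maxPathLength E S + 1)
  have : ∑ x ∈ S, f x ≤ S.card * maxPathLength E S := by
    rw [← smul_eq_mul]
    exact Finset.sum_le_card_nsmul _ _ _ fun x hx => (hl.lt_maxPathLength hx).le
  omega

/-- Every two disjoint `k`-sets are joined by an edge in each direction. -/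
def IsMixing {α : Type*} (T : α → α → Prop) (k : ℕ) : Prop :=
  ∀ A B : Finset α, A.card = k → B.card = k → Disjoint A B → ∃ a ∈ A, ∃ b ∈ B, T a b

theorem IsMixing.card_lt_or_card_lt {α : Type*} {T : α → α → Prop} {k : ℕ} (hT : IsMixing T k)
    {A B : Finset α} (hAB : Disjoint A B) (h : ∀ a ∈ A, ∀ b ∈ B, ¬ T a b) :
    A.card < k ∨ B.card < k := by
  by_contra! hk
  obtain ⟨A', hA', hAk⟩ := Finset.exists_subset_card_eq hk.1
  obtain ⟨B', hB', hBk⟩ := Finset.exists_subset_card_eq hk.2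
  obtain ⟨a, ha, b, hb, hab⟩ := hT A' B' hAk hBk (Finset.disjoint_of_subset_left hA'
    (Finset.disjoint_of_subset_right hB' hAB))
  exact h a (hA' ha) b (hB' hb) hab

theorem IsMixing.maxPathLength_add_le {α : Type*} {T H : α → α → Prop} {k : ℕ}
    (hT : IsMixing T k) {X Y S : Finset α} (hX : X ⊆ S) (hY : Y ⊆ S) (hXY : Disjoint X Y)
    (hH : ∀ x ∈ X, ∀ y ∈ Y, T x y → H x y) :
    maxPathLength H X + maxPathLength H Y ≤ maxPathLength H S + 2 * k := by
  classical
  have hXS := maxPathLength_mono H hX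
  have hYS := maxPathLength_mono H hY
  obtain ⟨l₁, ⟨hn₁, hm₁, hc₁⟩, hl₁⟩ := exists_isPathIn_length_eq_maxPathLength H X
  obtain ⟨l₂, ⟨hn₂, hm₂, hc₂⟩, hl₂⟩ := exists_isPathIn_length_eq_maxPathLength H Y
  by_cases h₁ : l₁.length < k
  · omega
  by_cases h₂ : l₂.length < k
  · omega
  have hd : ∀ x ∈ l₁, x ∉ l₂ := fun x hx hx' => Finset.disjoint_left.1 hXY (hm₁ x hx) (hm₂ x hx')
  obtain ⟨a, ha, b, hb, hab⟩ := hT (l₁.drop (l₁.length - k)).toFinset (l₂.take k).toFinset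
    (by rw [List.toFinset_card_of_nodup (hn₁.sublist (List.drop_sublist _ _)), List.length_drop]
        omega)
    (by rw [List.toFinset_card_of_nodup (hn₂.sublist (List.take_sublist _ _)), List.length_take]
        omega)
    (by
      rw [Finset.disjoint_left]
      intro x hx hx'
      exact hd x (List.mem_of_mem_drop (List.mem_toFinset.1 hx))
        (List.mem_of_mem_take (List.mem_toFinset.1 hx')))
  rw [List.mem_toFinset] at ha hb
  have hab' := hH a (hm₁ a (List.mem_of_mem_drop ha)) b (hm₂ b (List.mem_of_mem_take hb)) hab
  obtain ⟨s, t, hst⟩ := List.append_of_mem ha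
  obtain ⟨s', t', hst'⟩ := List.append_of_mem hb
  have e₁ : l₁ = (l₁.take (l₁.length - k) ++ s ++ [a]) ++ t := by
    conv_lhs => rw [← List.take_append_drop (l₁.length - k) l₁, hst]
    simp
  have e₂ : l₂ = s' ++ (b :: (t' ++ l₂.drop k)) := by
    conv_lhs => rw [← List.take_append_drop k l₂, hst']
    simp
  set p := l₁.take (l₁.length - k) ++ s
  set r := t' ++ l₂.drop k with hr
  have hplen : l₁.length - k ≤ p.length := by simp [p]
  have hrlen : l₂.length - k ≤ r.length := by simp [r]
  have hpsub : (p ++ [a]).Sublist l₁ := by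
    conv_rhs => rw [e₁]
    exact List.sublist_append_left _ _
  have hrsub : (b :: r).Sublist l₂ := by
    conv_rhs => rw [e₂]
    exact List.sublist_append_right _ _
  have hpath : IsPathIn_s2 H S ((p ++ [a]) ++ (b :: r)) := by
    refine ⟨?_, ?_, ?_⟩
    · refine List.nodup_append'.2 ⟨hn₁.sublist hpsub, hn₂.sublist hrsub, ?_⟩
      exact fun x hx hx' => hd x (hpsub.subset hx) (hrsub.subset hx')
    · intro x hx
      rcases List.mem_append.1 hx with hx | hx
      · exact hX (hm₁ x (hpsub.subset hx))
      · exact hY (hm₂ x (hrsub.subset hx))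
    · rw [List.append_assoc, List.singleton_append]
      refine List.isChain_append_cons_cons.2 ⟨?_, hab', ?_⟩
      · rw [e₁] at hc₁
        exact hc₁.left_of_append
      · rw [e₂] at hc₂
        exact hc₂.right_of_append
  have := hpath.length_le
  simp only [List.length_append, List.length_cons, List.length_nil] at this
  omega

/-- The sum of the lengths of the longest paths of the two colours. -/
noncomputable def pathSum {α : Type*} (B R : α → α → Prop) (S : Finset α) : ℕ :=
  maxPathLength B S + maxPathLength R S

/-- A set coloured with two colours has a subset of nearly half the size in which the longest
paths are, in total, nearly half as long. -/
theorem IsMixing.exists_halving {α : Type*} {T B R : α → α → Prop} {k : ℕ} (hT : IsMixing T k)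
    (S : Finset α) (hBR : ∀ u ∈ S, ∀ v ∈ S, T u v → B u v ∨ R u v) :
    ∃ S' ⊆ S, 2 * pathSum B R S' ≤ pathSum B R S + 4 * k ∧
      S.card ≤ 2 * S'.card + 2 * pathSum B R S + 4 * k := by
  classical
  obtain ⟨X, Y, hX, hY, hXY, hcXY, hnB, hcS⟩ := exists_balanced_nonadjacent B S
  have hXYS : X ∪ Y ⊆ S := Finset.union_subset hX hY
  obtain ⟨F, U, hF, hU, hFU, hcFU, hnR, hcU⟩ := exists_balanced_nonadjacent R (X ∪ Y)
  have hRS := maxPathLength_mono R hXYS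
  rw [Finset.card_union_of_disjoint hXY] at hcU
  have split : ∀ W ⊆ X ∪ Y, W.card = (W ∩ X).card + (W ∩ Y).card := by
    intro W hW
    rw [← Finset.card_union_of_disjoint, ← Finset.inter_union_distrib_left,
      Finset.inter_eq_left.2 hW]
    exact hXY.mono Finset.inter_subset_right Finset.inter_subset_right
  have hFs := split F hF
  have hUs := split U hU
  have hX' : (F ∩ X).card + (U ∩ X).card ≤ X.card := by
    rw [← Finset.card_union_of_disjoint
      (hFU.mono Finset.inter_subset_left Finset.inter_subset_left)]
    exact Finset.card_le_card (Finset.union_subset Finset.inter_subset_right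
      Finset.inter_subset_right)
  have hY' : (F ∩ Y).card + (U ∩ Y).card ≤ Y.card := by
    rw [← Finset.card_union_of_disjoint
      (hFU.mono Finset.inter_subset_left Finset.inter_subset_left)]
    exact Finset.card_le_card (Finset.union_subset Finset.inter_subset_right
      Finset.inter_subset_right)
  have hsmall : (F ∩ X).card < k ∨ (U ∩ Y).card < k := by
    apply hT.card_lt_or_card_lt
    · exact hFU.mono Finset.inter_subset_left Finset.inter_subset_left
    · intro a ha b hb hab
      rw [Finset.mem_inter] at ha hb
      rcases hBR a (hX ha.2) b (hY hb.2) hab with h | h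
      · exact hnB a ha.2 b hb.2 h
      · exact hnR a ha.1 b hb.1 h
  have hUXS : U ∩ X ⊆ S := Finset.inter_subset_right.trans hX
  have hFYS : F ∩ Y ⊆ S := Finset.inter_subset_right.trans hY
  have hdis : Disjoint (U ∩ X) (F ∩ Y) :=
    hXY.mono Finset.inter_subset_right Finset.inter_subset_right
  have hR := hT.maxPathLength_add_le (H := R) hUXS hFYS hdis (by
    intro x hx y hy hxy
    rw [Finset.mem_inter] at hx hy
    exact (hBR x (hX hx.2) y (hY hy.2) hxy).resolve_left (hnB x hx.2 y hy.2))
  have hB := hT.maxPathLength_add_le (H := B) hFYS hUXS hdis.symm (by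
    intro x hx y hy hxy
    rw [Finset.mem_inter] at hx hy
    exact (hBR x (hY hx.2) y (hX hy.2) hxy).resolve_right (hnR x hx.1 y hy.1))
  have hcard : S.card ≤ 2 * (U ∩ X).card + 2 * pathSum B R S + 4 * k ∧
      S.card ≤ 2 * (F ∩ Y).card + 2 * pathSum B R S + 4 * k := by
    unfold pathSum
    omega
  by_cases hle : pathSum B R (U ∩ X) ≤ pathSum B R (F ∩ Y)
  · refine ⟨U ∩ X, hUXS, ?_, hcard.1⟩
    unfold pathSum at *
    omega
  · refine ⟨F ∩ Y, hFYS, ?_, hcard.2⟩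
    unfold pathSum at *
    omega

theorem IsMixing.exists_iterated_halving {α : Type*} {T B R : α → α → Prop} {k : ℕ}
    (hT : IsMixing T k) (S : Finset α) (hBR : ∀ u ∈ S, ∀ v ∈ S, T u v → B u v ∨ R u v) (i : ℕ) :
    ∃ S' ⊆ S, 2 ^ i * pathSum B R S' ≤ 2 ^ i * (4 * k) + pathSum B R S ∧
      S.card ≤ 2 ^ i * S'.card + 2 * i * pathSum B R S + 12 * k * 2 ^ i := by
  induction i with
  | zero => exact ⟨S, subset_rfl, by simp, by simp⟩
  | succ i ih =>
    obtain ⟨S', hS', hg, hc⟩ := ih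
    obtain ⟨S'', hS'', hg', hc'⟩ := hT.exists_halving S'
      fun u hu v hv => hBR u (hS' hu) v (hS' hv)
    have hg₂ := Nat.mul_le_mul_left (2 ^ i) hg'
    have hc₂ := Nat.mul_le_mul_left (2 ^ i) hc'
    refine ⟨S'', hS''.trans hS', ?_, ?_⟩
    · rw [pow_succ]; linarith
    · rw [pow_succ]; linarith

theorem card_le_maxPathLength_mul {α : Type*} {T B R : α → α → Prop} (S : Finset α)
    (hT : ∀ u ∈ S, ∀ v ∈ S, u ≠ v → T u v ∨ T v u)
    (hBR : ∀ u ∈ S, ∀ v ∈ S, T u v → B u v ∨ R u v) :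
    S.card ≤ maxPathLength B S * maxPathLength R S := by
  obtain ⟨f, hf, hf'⟩ := exists_coloring_lt_maxPathLength B S
  obtain ⟨g, hg, hg'⟩ := exists_coloring_lt_maxPathLength R S
  have : S.card ≤
      (Finset.range (maxPathLength B S) ×ˢ Finset.range (maxPathLength R S)).card := by
    apply Finset.card_le_card_of_injOn (fun v => (f v, g v))
    · intro v hv
      have hv : v ∈ S := hv
      simp [hf v hv, hg v hv]
    · have key : ∀ u ∈ S, ∀ v ∈ S, u ≠ v → T u v → (f u, g u) ≠ (f v, g v) := by
        intro u hu v hv huv h heq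
        rw [Prod.mk.injEq] at heq
        rcases hBR u hu v hv h with h | h
        · exact hf' u hu v hv huv h heq.1
        · exact hg' u hu v hv huv h heq.2
      intro u hu v hv heq
      by_contra huv
      rcases hT u hu v hv huv with h | h
      · exact key u hu v hv huv h heq
      · exact key v hv u hu (Ne.symm huv) h heq.symm
  simpa using this

theorem IsMixing.card_le_of_maxPathLength_le {α : Type*} {T B R : α → α → Prop} {k n L : ℕ}
    (hT : IsMixing T k) (S : Finset α) (htot : ∀ u ∈ S, ∀ v ∈ S, u ≠ v → T u v ∨ T v u)
    (hBR : ∀ u ∈ S, ∀ v ∈ S, T u v → B u v ∨ R u v) (hk : 0 < k) (hkn : k ≤ n) (hL : n < 2 ^ L)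
    (hB : maxPathLength B S ≤ n) (hR : maxPathLength R S ≤ n) :
    S.card ≤ (16 * k + 4 * L + 12) * n := by
  set i := Nat.log 2 (n / k) with hi
  have h1 : k * 2 ^ i ≤ n := by
    have := Nat.pow_log_le_self 2 (x := n / k) (Nat.div_pos hkn hk).ne'
    calc k * 2 ^ i ≤ k * (n / k) := Nat.mul_le_mul_left _ this
      _ ≤ n := Nat.mul_div_le n k
  have h2 : n < 2 * (k * 2 ^ i) := by
    have := Nat.lt_pow_succ_log_self (b := 2) (by norm_num) (n / k)
    rw [Nat.div_lt_iff_lt_mul hk, ← hi, pow_succ] at this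
    linarith
  have hiL : i ≤ L := by
    have : 2 ^ i ≤ n := le_trans (Nat.le_mul_of_pos_left _ hk) h1
    exact ((Nat.pow_lt_pow_iff_right (a := 2) (by norm_num)).1 (this.trans_lt hL)).le
  obtain ⟨S', hS', hg, hc⟩ := hT.exists_iterated_halving S hBR i
  have hgS : pathSum B R S ≤ 2 * n := by unfold pathSum; omega
  have hg8 : pathSum B R S' < 8 * k := by
    apply Nat.lt_of_mul_lt_mul_left (a := 2 ^ i)
    linarith
  have hcS' := card_le_maxPathLength_mul S' (fun u hu v hv => htot u (hS' hu) v (hS' hv))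
    fun u hu v hv => hBR u (hS' hu) v (hS' hv)
  have h16 : S'.card ≤ 16 * k * k := by
    unfold pathSum at hg8
    zify at *
    nlinarith [sq_nonneg ((maxPathLength B S' : ℤ) - maxPathLength R S')]
  have e1 : 2 ^ i * S'.card ≤ 16 * k * n := by
    calc 2 ^ i * S'.card ≤ 2 ^ i * (16 * k * k) := Nat.mul_le_mul_left _ h16
      _ = 16 * k * (k * 2 ^ i) := by ring
      _ ≤ 16 * k * n := Nat.mul_le_mul_left _ h1
  have e2 : 2 * i * pathSum B R S ≤ 2 * L * (2 * n) := by gcongr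
  linarith

/-- The tournament on `Fin N` encoded by a bit for each pair of vertices. -/
def bitTournament {N : ℕ} (f : Fin N × Fin N → Bool) (u v : Fin N) : Prop :=
  u ≠ v ∧ f (min u v, max u v) = decide (u < v)

theorem isTournament_bitTournament {N : ℕ} (f : Fin N × Fin N → Bool) :
    IsTournament (bitTournament f) := by
  refine ⟨fun u h => h.1 rfl, fun u v huv => ?_⟩
  unfold bitTournament
  rw [min_comm v u, max_comm v u]
  rcases lt_or_gt_of_ne huv with h | h
  · simp [h, huv, huv.symm, h.not_gt]
  · simp [h, huv, huv.symm, h.not_gt]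

open Classical in
theorem two_pow_mul_card_bitTournament_le {N k : ℕ} (A B : Finset (Fin N)) (hA : A.card = k)
    (hB : B.card = k) (hAB : Disjoint A B) :
    2 ^ (k * k) * (Finset.univ.filter fun f : Fin N × Fin N → Bool =>
      ∀ a ∈ A, ∀ b ∈ B, ¬ bitTournament f a b).card ≤ 2 ^ (N * N) := by
  set D := (A ×ˢ B).image fun e => (min e.1 e.2, max e.1 e.2) with hD
  have hne : ∀ a ∈ A, ∀ b ∈ B, a ≠ b := fun a ha b hb h => Finset.disjoint_left.1 hAB ha (h ▸ hb)
  have hDcard : D.card = k * k := by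
    rw [hD, Finset.card_image_of_injOn, Finset.card_product, hA, hB]
    rintro ⟨a, b⟩ h ⟨a', b'⟩ h' heq
    simp only [Finset.coe_product, Set.mem_prod, Finset.mem_coe] at h h'
    simp only [Prod.mk.injEq] at heq ⊢
    have h1 := hne a h.1 b' h'.2
    have h2 := hne a' h'.1 b h.2
    rcases le_total a b with hab | hab <;> rcases le_total a' b' with hab' | hab' <;>
      simp_all
  have hsub : (Finset.univ.filter fun f : Fin N × Fin N → Bool =>
      ∀ a ∈ A, ∀ b ∈ B, ¬ bitTournament f a b) ⊆
      Fintype.piFinset fun e => if e ∈ D then {decide (e.1 ∉ A)} else Finset.univ := by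
    intro f hf
    rw [Finset.mem_filter] at hf
    rw [Fintype.mem_piFinset]
    intro e
    split_ifs with he
    · obtain ⟨⟨a, b⟩, hab, rfl⟩ := Finset.mem_image.1 he
      rw [Finset.mem_product] at hab
      have h1 := hf.2 a hab.1 b hab.2
      have h2 := hne a hab.1 b hab.2
      have hbA : b ∉ A := fun h => Finset.disjoint_left.1 hAB h hab.2
      unfold bitTournament at h1
      rw [Finset.mem_singleton]
      rcases lt_or_gt_of_ne h2 with h | h
      · simpa [h, h.le, h2, hab.1] using h1
      · simpa [h, h.le, h2, hbA, h.not_gt] using h1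
    · exact Finset.mem_univ _
  have hcard : (Fintype.piFinset fun e : Fin N × Fin N =>
      if e ∈ D then {decide (e.1 ∉ A)} else (Finset.univ : Finset Bool)).card * 2 ^ (k * k) =
      2 ^ (N * N) := by
    have h : ∀ e : Fin N × Fin N, (if e ∈ D then {decide (e.1 ∉ A)} else
        (Finset.univ : Finset Bool)).card * (if e ∈ D then 2 else 1) = 2 := by
      intro e
      split_ifs <;> simp
    rw [Fintype.card_piFinset, ← hDcard, ← Finset.prod_const, ← Finset.prod_filter_mul_prod_filter_not
      Finset.univ (· ∈ D)]
    have e1 : ∏ _e ∈ D, 2 = ∏ e : Fin N × Fin N, if e ∈ D then 2 else 1 := by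
      rw [Finset.prod_ite_mem, Finset.univ_inter]
    rw [Finset.prod_filter_mul_prod_filter_not, e1, ← Finset.prod_mul_distrib,
      Finset.prod_congr rfl fun e _ => h e]
    simp
  calc _ ≤ 2 ^ (k * k) * _ := Nat.mul_le_mul_left _ (Finset.card_le_card hsub)
    _ = _ := by rw [mul_comm, hcard]

theorem exists_isTournament_isMixing {N k : ℕ} (hk : 0 < k) (h : N ^ 2 < 2 ^ k) :
    ∃ T : Fin N → Fin N → Prop, IsTournament T ∧ IsMixing T k := by
  classical
  by_contra hcon
  set P := Finset.powersetCard k (Finset.univ : Finset (Fin N)) with hP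
  set bad : Finset (Fin N) × Finset (Fin N) → Finset (Fin N × Fin N → Bool) := fun e =>
    Finset.univ.filter fun f => ∀ a ∈ e.1, ∀ b ∈ e.2, ¬ bitTournament f a b with hbad
  have hcover : (Finset.univ : Finset (Fin N × Fin N → Bool)) ⊆
      ((P ×ˢ P).filter fun e => Disjoint e.1 e.2).biUnion bad := by
    intro f _
    by_contra hf
    refine hcon ⟨bitTournament f, isTournament_bitTournament f, fun A B hA hB hAB => ?_⟩
    by_contra! hno
    refine hf (Finset.mem_biUnion.2 ⟨(A, B), ?_, ?_⟩)
    · simp [hP, Finset.mem_powersetCard, hA, hB, hAB]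
    · simpa [hbad] using hno
  have h1 := Finset.card_le_card hcover
  have h2 : 2 ^ (k * k) * (((P ×ˢ P).filter fun e => Disjoint e.1 e.2).biUnion bad).card ≤
      (N ^ k * N ^ k) * 2 ^ (N * N) := by
    calc _ ≤ 2 ^ (k * k) * ∑ e ∈ (P ×ˢ P).filter fun e => Disjoint e.1 e.2, (bad e).card :=
          Nat.mul_le_mul_left _ Finset.card_biUnion_le
      _ = ∑ e ∈ (P ×ˢ P).filter fun e => Disjoint e.1 e.2, 2 ^ (k * k) * (bad e).card :=
          Finset.mul_sum _ _ _
      _ ≤ ((P ×ˢ P).filter fun e => Disjoint e.1 e.2).card • 2 ^ (N * N) := by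
          refine Finset.sum_le_card_nsmul _ _ _ fun e he => ?_
          simp only [Finset.mem_filter, Finset.mem_product, hP, Finset.mem_powersetCard] at he
          exact two_pow_mul_card_bitTournament_le e.1 e.2 he.1.1.2 he.1.2.2 he.2
      _ ≤ (N ^ k * N ^ k) * 2 ^ (N * N) := by
          rw [smul_eq_mul]
          apply Nat.mul_le_mul_right
          refine (Finset.card_filter_le _ _).trans ?_
          rw [Finset.card_product, hP, Finset.card_powersetCard, Finset.card_univ, Fintype.card_fin]
          exact Nat.mul_le_mul (Nat.choose_le_pow _ _) (Nat.choose_le_pow _ _)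
  have h3 : N ^ k * N ^ k < 2 ^ (k * k) := by
    calc N ^ k * N ^ k = (N ^ 2) ^ k := by ring
      _ < (2 ^ k) ^ k := Nat.pow_lt_pow_left h hk.ne'
      _ = 2 ^ (k * k) := by rw [pow_mul]
  have h4 : (Finset.univ : Finset (Fin N × Fin N → Bool)).card = 2 ^ (N * N) := by simp
  rw [h4] at h1
  have h5 := Nat.mul_le_mul_left (2 ^ (k * k)) h1
  have h6 := Nat.mul_lt_mul_of_pos_right h3 (show 0 < 2 ^ (N * N) by positivity)
  omega

theorem IsPathIn_s2.exists_fin {V : Type} {H : V → V → Prop} {S : Finset V} {l : List V}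
    (h : IsPathIn_s2 H S l) {m : ℕ} (hm : m + 1 ≤ l.length) :
    ∃ p : Fin (m + 1) → V, Function.Injective p ∧ ∀ i : Fin m, H (p i.castSucc) (p i.succ) := by
  refine ⟨fun i => l[i.1]'(by omega), ?_, ?_⟩
  · intro i j hij
    exact Fin.ext ((h.1.getElem_inj_iff).1 hij)
  · intro i
    exact List.isChain_iff_getElem.1 h.2.2 i.1 (by omega)

theorem exists_mono_path_s2 {V : Type} [Fintype V] {p n k L : ℕ} {Adj : V → V → Prop}
    (hT : IsTournament Adj) (hmix : IsMixing Adj k) (hk : 0 < k) (hkn : k ≤ n) (hL : n < 2 ^ L)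
    (hcard : n ^ p * ((16 * k + 4 * L + 12) * n + 1) ≤ Fintype.card V)
    (c : V → V → Fin (p + 1 + 1)) :
    ∃ P : Fin (n - 1 + 1) → V, IsDiPath Adj P ∧ IsMono c P := by
  classical
  by_contra hcon
  set E : Fin (p + 1 + 1) → V → V → Prop := fun i u v => Adj u v ∧ c u v = i with hE
  have hlt : ∀ i, maxPathLength (E i) Finset.univ < n := by
    intro i
    by_contra! hi
    obtain ⟨l, hl, hlen⟩ := exists_isPathIn_length_eq_maxPathLength (E i) Finset.univ
    obtain ⟨P, hP, hP'⟩ := hl.exists_fin (m := n - 1) (by omega)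
    exact hcon ⟨P, ⟨hP, fun j => (hP' j).1⟩, i, fun j => (hP' j).2⟩
  choose f hf hf' using fun i => exists_coloring_lt_maxPathLength (E i) Finset.univ
  obtain ⟨y, -, hy⟩ := Finset.exists_le_card_fiber_of_mul_le_card_of_maps_to
    (s := (Finset.univ : Finset V)) (t := Fintype.piFinset fun _ : Fin p => Finset.range n)
    (f := fun v i => f i.castSucc.castSucc v) (n := (16 * k + 4 * L + 12) * n + 1)
    (by
      intro v _
      rw [Fintype.mem_piFinset]
      exact fun i => Finset.mem_range.2 ((hf _ v (Finset.mem_univ v)).trans (hlt _)))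
    ⟨fun _ => 0, by
      rw [Fintype.mem_piFinset]
      exact fun i => Finset.mem_range.2 (by omega)⟩
    (by simpa [Fintype.card_piFinset] using hcard)
  set S := Finset.univ.filter fun v => (fun i : Fin p => f i.castSucc.castSucc v) = y
  have hne : ∀ u v, Adj u v → u ≠ v := fun u v h huv => hT.1 u (huv ▸ h)
  have := hmix.card_le_of_maxPathLength_le (B := E (Fin.last p).castSucc) (R := E (Fin.last _)) S
    (by
      intro u _ v _ huv
      by_cases h : Adj v u
      · exact Or.inr h
      · exact Or.inl ((hT.2 u v huv).2 h))
    (by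
      intro u hu v hv huv
      generalize hcol : c u v = col
      induction col using Fin.lastCases with
      | last => exact Or.inr ⟨huv, hcol⟩
      | cast col =>
        induction col using Fin.lastCases with
        | last => exact Or.inl ⟨huv, hcol⟩
        | cast i =>
          have h1 := congrFun (Finset.mem_filter.1 hu).2 i
          have h2 := congrFun (Finset.mem_filter.1 hv).2 i
          exact absurd (h1.trans h2.symm) (hf' _ u (Finset.mem_univ _) v (Finset.mem_univ _)
            (hne u v huv) ⟨huv, hcol⟩))
    hk hkn hL
    ((maxPathLength_mono _ (Finset.subset_univ _)).trans (hlt _).le)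
    ((maxPathLength_mono _ (Finset.subset_univ _)).trans (hlt _).le)
  omega

theorem sq_le_two_pow {m : ℕ} (hm : 4 ≤ m) : m ^ 2 ≤ 2 ^ m := by
  induction m, hm using Nat.le_induction with
  | base => norm_num
  | succ m hm ih => rw [pow_succ 2 m]; nlinarith

/-- For every `q ≥ 1` there are `C > 0` and `n₀` such that for every `n ≥ n₀` there is a
tournament on `⌈C · n^q · log n⌉` vertices in which every `(q+1)`-coloring of the edges
contains a monochromatic directed path on `n` vertices (i.e. with `n - 1` edges).
Logarithms are base 2. -/
theorem stmt_2 (q : ℕ) (hq : 1 ≤ q) :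
    ∃ (C : ℝ) (n₀ : ℕ), 0 < C ∧
      ∀ n : ℕ, n₀ ≤ n →
        ∃ Adj : Fin ⌈C * (n : ℝ) ^ q * Real.logb 2 n⌉₊ →
                Fin ⌈C * (n : ℝ) ^ q * Real.logb 2 n⌉₊ → Prop,
          IsTournament Adj ∧
          ∀ c : Fin ⌈C * (n : ℝ) ^ q * Real.logb 2 n⌉₊ →
                Fin ⌈C * (n : ℝ) ^ q * Real.logb 2 n⌉₊ → Fin (q + 1),
            ∃ p : Fin (n - 1 + 1) → Fin ⌈C * (n : ℝ) ^ q * Real.logb 2 n⌉₊,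
              IsDiPath Adj p ∧ IsMono c p := by
  obtain ⟨p, rfl⟩ : ∃ p, q = p + 1 := ⟨q - 1, by omega⟩
  obtain ⟨a, ha⟩ : ∃ a, a = 2 * (p + 3) := ⟨_, rfl⟩
  refine ⟨32 * a + 40, 2 ^ (4 * a), by positivity, fun n hn => ?_⟩
  obtain ⟨m, hm⟩ : ∃ m, m = Nat.log 2 n := ⟨_, rfl⟩
  have hn0 : 0 < n := lt_of_lt_of_le (by positivity) hn
  have hmn : 2 ^ m ≤ n := hm ▸ Nat.pow_log_le_self 2 hn0.ne'
  have hnm : n < 2 ^ (m + 1) := hm ▸ Nat.lt_pow_succ_log_self (by norm_num) n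
  have ham : 4 * a ≤ m := hm ▸ Nat.le_log_of_pow_le (by norm_num) hn
  have hkn : a * (m + 1) ≤ n := by
    have := sq_le_two_pow (show 4 ≤ m by omega)
    nlinarith
  have hCn : 32 * a + 41 ≤ n := by
    have := sq_le_two_pow (show 4 ≤ 4 * a by omega)
    nlinarith
  have hnR : (0 : ℝ) < n := by exact_mod_cast hn0
  have hlog1 : (m : ℝ) ≤ Real.logb 2 n := by
    rw [Real.le_logb_iff_rpow_le (by norm_num) hnR, Real.rpow_natCast]
    exact_mod_cast hmn
  have hlog0 : 0 ≤ Real.logb 2 (n : ℝ) := (Nat.cast_nonneg m).trans hlog1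
  have hlog2 : Real.logb 2 n ≤ (m + 1 : ℕ) := by
    rw [Real.logb_le_iff_le_rpow (by norm_num) hnR, Real.rpow_natCast]
    exact_mod_cast hnm.le
  set N := ⌈(32 * a + 40 : ℝ) * (n : ℝ) ^ (p + 1) * Real.logb 2 n⌉₊ with hN
  have hupper : N ≤ n ^ (p + 3) := by
    refine Nat.ceil_le.2 ?_
    have h1 : Real.logb 2 n ≤ n := by
      refine hlog2.trans (Nat.cast_le.2 (le_trans ?_ hkn))
      nlinarith
    have h2 : (32 * a + 40 : ℝ) ≤ n := by
      have : ((32 * a + 41 : ℕ) : ℝ) ≤ n := Nat.cast_le.2 hCn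
      push_cast at this
      linarith
    calc (32 * a + 40 : ℝ) * (n : ℝ) ^ (p + 1) * Real.logb 2 n
        ≤ n * (n : ℝ) ^ (p + 1) * n := by gcongr
      _ = ((n ^ (p + 3) : ℕ) : ℝ) := by push_cast; ring
  have hNk : N ^ 2 < 2 ^ (a * (m + 1)) := by
    calc N ^ 2 ≤ (n ^ (p + 3)) ^ 2 := Nat.pow_le_pow_left hupper 2
      _ = n ^ a := by rw [← pow_mul, ha, mul_comm]
      _ < (2 ^ (m + 1)) ^ a := Nat.pow_lt_pow_left hnm (by omega)
      _ = 2 ^ (a * (m + 1)) := by rw [← pow_mul, mul_comm]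
  have hlower : n ^ p * ((16 * (a * (m + 1)) + 4 * (m + 1) + 12) * n + 1) ≤ N := by
    have h1 : (16 * (a * (m + 1)) + 4 * (m + 1) + 12) * n + 1 ≤ (32 * a + 40) * m * n := by
      have : 16 * (a * (m + 1)) + 4 * (m + 1) + 13 ≤ (32 * a + 40) * m := by nlinarith
      nlinarith
    have h2 := Nat.mul_le_mul_left (n ^ p) h1
    refine h2.trans ?_
    rw [← Nat.cast_le (α := ℝ)]
    refine le_trans ?_ (Nat.le_ceil _)
    push_cast
    calc (n : ℝ) ^ p * ((32 * a + 40) * m * n) = (32 * a + 40) * (n : ℝ) ^ (p + 1) * m := by ring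
      _ ≤ _ := by gcongr
  have hk : 0 < a * (m + 1) := Nat.mul_pos (by omega) (by omega)
  obtain ⟨T, hT, hmix⟩ := exists_isTournament_isMixing hk hNk
  exact ⟨T, hT, fun c => exists_mono_path_s2 hT hmix hk hkn hnm (by simpa using hlower) c⟩
end
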